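/- arXiv:2501.15033 — 4 statements merged into one kernel-verified Lean document; each statement's English description precedes it below -/
import Mathlib

section
/- The linear sieve functions at the endpoints of the computed ranges are very close to 1: F₃(7) ≤ 1.0000050 and f₃(8) ≥ 0.9999648. -/
/-- The upper linear sieve function `F₃`, valid for `5 ≤ s ≤ 7`. -/
noncomputable def F₃ (s : ℝ) : ℝ :=
  (2 * Real.exp Real.eulerMascheroniConstant / s) *
    (1 + (∫ t in (2:ℝ)..(s - 1), Real.log (t - 1) / t)
      + ∫ t in (2:ℝ)..(s - 3), (Real.log (t - 1) / t) *
          ∫ u in (t + 2)..(s - 1), (1 / u) * Real.log ((u - 1) / (t + 1)))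

/-- The lower linear sieve function `f₃`, valid for `6 ≤ s ≤ 8`. -/
noncomputable def f₃ (s : ℝ) : ℝ :=
  (2 * Real.exp Real.eulerMascheroniConstant / s) *
    (Real.log (s - 1)
      + (∫ t in (3:ℝ)..(s - 1), (1 / t) * ∫ u in (2:ℝ)..(t - 1), Real.log (u - 1) / u)
      + ∫ t in (2:ℝ)..(s - 4), (Real.log (t - 1) / t) *
          ∫ u in (t + 2)..(s - 2),
            (1 / u) * Real.log ((u - 1) / (t + 1)) * Real.log (s / (u + 2)))

open Set MeasureTheory

/-- The value at `x` of the polynomial with coefficient list `p`, constant term first. -/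
noncomputable def polyEval : List ℚ → ℝ → ℝ
  | [], _ => 0
  | a :: p, x => a + x * polyEval p x

/-- The value of a coefficient list at a rational point. -/
def polyEvalRat : List ℚ → ℚ → ℚ
  | [], _ => 0
  | a :: p, x => a + x * polyEvalRat p x

/-- The sum of two coefficient lists. -/
def polyAdd : List ℚ → List ℚ → List ℚ
  | [], q => q
  | p, [] => p
  | a :: p, b :: q => (a + b) :: polyAdd p q

/-- A scalar multiple of a coefficient list. -/
def polyScale (c : ℚ) : List ℚ → List ℚ
  | [] => []
  | a :: p => (c * a) :: polyScale c p

/-- The product of two coefficient lists. -/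
def polyMul : List ℚ → List ℚ → List ℚ
  | [], _ => []
  | a :: p, q => polyAdd (polyScale a q) (0 :: polyMul p q)

/-- The coefficients of the antiderivative of `x ^ k * p x` that vanishes at `0`,
divided by `x ^ (k + 1)`. -/
def polyPrimAux : ℕ → List ℚ → List ℚ
  | _, [] => []
  | k, a :: p => a / (k + 1) :: polyPrimAux (k + 1) p

/-- The antiderivative of a coefficient list with constant term `0`. -/
def polyPrim (p : List ℚ) : List ℚ := 0 :: polyPrimAux 0 p

/-- The sum of the absolute values of the coefficients. -/
def polyNorm : List ℚ → ℚ
  | [] => 0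
  | a :: p => |a| + polyNorm p

theorem polyEval_ratCast (p : List ℚ) (x : ℚ) : polyEval p x = (polyEvalRat p x : ℚ) := by
  induction p with
  | nil => simp [polyEval, polyEvalRat]
  | cons a p ih => simp [polyEval, polyEvalRat, ih]

theorem polyEval_add (p q : List ℚ) (x : ℝ) :
    polyEval (polyAdd p q) x = polyEval p x + polyEval q x := by
  induction p generalizing q with
  | nil => simp [polyAdd, polyEval]
  | cons a p ih =>
    cases q with
    | nil => simp [polyAdd, polyEval]
    | cons b q => simp only [polyAdd, polyEval, ih]; push_cast; ring

theorem polyEval_scale (c : ℚ) (p : List ℚ) (x : ℝ) :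
    polyEval (polyScale c p) x = c * polyEval p x := by
  induction p with
  | nil => simp [polyScale, polyEval]
  | cons a p ih => simp only [polyScale, polyEval, ih]; push_cast; ring

theorem polyEval_mul (p q : List ℚ) (x : ℝ) :
    polyEval (polyMul p q) x = polyEval p x * polyEval q x := by
  induction p with
  | nil => simp [polyMul, polyEval]
  | cons a p ih =>
    simp only [polyMul, polyEval, ih, polyEval_add, polyEval_scale]; push_cast; ring

theorem hasDerivAt_polyPrimAux (k : ℕ) (p : List ℚ) (x : ℝ) :
    HasDerivAt (fun y => y ^ (k + 1) * polyEval (polyPrimAux k p) y) (x ^ k * polyEval p x) x := by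
  induction p generalizing k with
  | nil => simpa [polyPrimAux, polyEval] using hasDerivAt_const x (0 : ℝ)
  | cons a p ih =>
    have hk : (k : ℝ) + 1 ≠ 0 := by positivity
    have h1 := ((hasDerivAt_pow (k + 1) x).mul_const ((a : ℝ) / (k + 1))).add (ih (k + 1))
    refine (h1.congr_of_eventuallyEq (Filter.Eventually.of_forall fun y => ?_)).congr_deriv ?_
    · simp only [polyPrimAux, polyEval, Pi.add_apply]; push_cast; ring
    · simp only [polyEval, Nat.add_sub_cancel]; push_cast; field_simp; ring

theorem hasDerivAt_polyPrim (p : List ℚ) (x : ℝ) :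
    HasDerivAt (polyEval (polyPrim p)) (polyEval p x) x := by
  have h := hasDerivAt_polyPrimAux 0 p x
  simp only [zero_add, pow_one, pow_zero, one_mul] at h
  convert h using 1
  ext y
  simp [polyPrim, polyEval]

theorem continuous_polyEval (p : List ℚ) : Continuous (polyEval p) := by
  induction p with
  | nil => exact continuous_const
  | cons a p ih => exact continuous_const.add (continuous_id.mul ih)

theorem integral_polyEval (p : List ℚ) (a b : ℝ) :
    ∫ x in a..b, polyEval p x = polyEval (polyPrim p) b - polyEval (polyPrim p) a :=
  intervalIntegral.integral_eq_sub_of_hasDerivAt (fun x _ => hasDerivAt_polyPrim p x)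
    ((continuous_polyEval p).intervalIntegrable _ _)

theorem abs_polyEval_le (p : List ℚ) {x : ℝ} (hx : |x| ≤ 1) :
    |polyEval p x| ≤ polyNorm p := by
  induction p with
  | nil => simp [polyEval, polyNorm]
  | cons a p ih =>
    simp only [polyEval, polyNorm]
    push_cast
    refine (abs_add_le _ _).trans ?_
    rw [abs_mul]
    have := mul_le_mul hx ih (abs_nonneg _) zero_le_one
    linarith

theorem polyEval_map_range (a : ℕ → ℚ) (n : ℕ) (x : ℝ) :
    polyEval ((List.range n).map a) x = ∑ i ∈ Finset.range n, (a i : ℝ) * x ^ i := by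
  induction n generalizing a with
  | zero => simp [polyEval]
  | succ n ih =>
    rw [List.range_succ_eq_map, List.map_cons, List.map_map, polyEval, ih, Finset.sum_range_succ',
      Finset.mul_sum, add_comm]
    simp only [Function.comp, pow_zero, mul_one, add_left_inj]
    exact Finset.sum_congr rfl fun i _ => by rw [Nat.succ_eq_add_one, pow_succ]; ring

/-- A polynomial together with an error bound for approximation on `[-1, 1]`. -/
structure TaylorModel where
  /-- The coefficients of the approximating polynomial. -/
  poly : List ℚ
  /-- The error bound. -/
  err : ℚ

namespace TaylorModel

/-- The polynomial of `T` is within the error bound of `f` on `[-1, 1]`. -/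
def Encloses (T : TaylorModel) (f : ℝ → ℝ) : Prop :=
  ∀ x : ℝ, |x| ≤ 1 → |f x - polyEval T.poly x| ≤ T.err

/-- The model of a rational constant. -/
def const (c : ℚ) : TaylorModel := ⟨[c], 0⟩

/-- The model of a sum. -/
def add (S T : TaylorModel) : TaylorModel := ⟨polyAdd S.poly T.poly, S.err + T.err⟩

/-- The model of a rational multiple. -/
def scale (c : ℚ) (T : TaylorModel) : TaylorModel := ⟨polyScale c T.poly, |c| * T.err⟩

/-- The model of a product. -/
def mul (S T : TaylorModel) : TaylorModel :=
  ⟨polyMul S.poly T.poly, S.err * (polyNorm T.poly + T.err) + polyNorm S.poly * T.err⟩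

/-- The model of the constant function with value `f q`. -/
def constAt (T : TaylorModel) (q : ℚ) : TaylorModel := ⟨[polyEvalRat T.poly q], T.err⟩

/-- The model of `x ↦ ∫ y in x..1, f y`. -/
def integralToOne (T : TaylorModel) : TaylorModel :=
  ⟨polyAdd [polyEvalRat (polyPrim T.poly) 1] (polyScale (-1) (polyPrim T.poly)), 2 * T.err⟩

/-- The integral over `[-1, 1]` of the polynomial of a model. -/
def integral (T : TaylorModel) : ℚ :=
  polyEvalRat (polyPrim T.poly) 1 - polyEvalRat (polyPrim T.poly) (-1)

/-- The model of `x ↦ log (1 + x / c)` of degree `n`. -/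
def logOneAddDiv (c : ℚ) (n : ℕ) : TaylorModel :=
  ⟨0 :: (List.range n).map fun i : ℕ => (-1) ^ i / (((i : ℚ) + 1) * c ^ (i + 1)),
    (1 / c) ^ (n + 1) / (1 - 1 / c)⟩

/-- The model of `x ↦ 1 / (c + x)` with `n` coefficients. -/
def oneDivAdd (c : ℚ) (n : ℕ) : TaylorModel :=
  ⟨(List.range n).map fun i : ℕ => (-1) ^ i / c ^ (i + 1), (1 / c) ^ n / (c - 1)⟩

variable {S T : TaylorModel} {f g : ℝ → ℝ}

theorem Encloses.congr (h : T.Encloses f) (hfg : ∀ x : ℝ, |x| ≤ 1 → g x = f x) :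
    T.Encloses g := fun x hx => by rw [hfg x hx]; exact h x hx

theorem encloses_const (c : ℚ) : (const c).Encloses fun _ => (c : ℝ) := fun x _ => by
  simp [const, polyEval]

theorem Encloses.add (hf : S.Encloses f) (hg : T.Encloses g) :
    (S.add T).Encloses fun x => f x + g x := fun x hx => by
  simp only [TaylorModel.add, polyEval_add]
  push_cast
  rw [add_sub_add_comm]
  exact (abs_add_le _ _).trans (add_le_add (hf x hx) (hg x hx))

theorem Encloses.scale (c : ℚ) (hf : T.Encloses f) :
    (T.scale c).Encloses fun x => c * f x := fun x hx => by
  simp only [TaylorModel.scale, polyEval_scale]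
  push_cast
  rw [← mul_sub, abs_mul]
  exact mul_le_mul_of_nonneg_left (hf x hx) (abs_nonneg _)

theorem Encloses.mul (hf : S.Encloses f) (hg : T.Encloses g) :
    (S.mul T).Encloses fun x => f x * g x := fun x hx => by
  simp only [TaylorModel.mul, polyEval_mul]
  push_cast
  have h1 := hf x hx
  have h2 := hg x hx
  have h3 := abs_polyEval_le S.poly hx
  have h4 := abs_polyEval_le T.poly hx
  have h5 : |g x| ≤ polyNorm T.poly + T.err := by
    have := abs_add_le (polyEval T.poly x) (g x - polyEval T.poly x)
    rw [add_sub_cancel] at this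
    linarith
  have key : f x * g x - polyEval S.poly x * polyEval T.poly x =
      (f x - polyEval S.poly x) * g x + polyEval S.poly x * (g x - polyEval T.poly x) := by ring
  rw [key]
  refine (abs_add_le _ _).trans ?_
  rw [abs_mul, abs_mul]
  exact add_le_add (mul_le_mul h1 h5 (abs_nonneg _) ((abs_nonneg _).trans h1))
    (mul_le_mul h3 h2 (abs_nonneg _) ((abs_nonneg _).trans h3))

theorem Encloses.constAt (hf : T.Encloses f) (q : ℚ) (hq : |q| ≤ 1) :
    (T.constAt q).Encloses fun _ => f q := fun x _ => by
  have h := hf q (by exact_mod_cast hq)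
  simpa [TaylorModel.constAt, polyEval, polyEval_ratCast] using h

theorem Encloses.abs_integral_sub_le (hf : T.Encloses f) {a b : ℝ} (ha : |a| ≤ 1) (hb : |b| ≤ 1)
    (hint : IntervalIntegrable f volume a b) :
    |(∫ x in a..b, f x) - (polyEval (polyPrim T.poly) b - polyEval (polyPrim T.poly) a)|
      ≤ 2 * T.err := by
  rw [← integral_polyEval, ← intervalIntegral.integral_sub hint
    ((continuous_polyEval _).intervalIntegrable _ _)]
  have h0 : (0 : ℝ) ≤ T.err := (abs_nonneg _).trans (hf a ha)
  have h := intervalIntegral.norm_integral_le_of_norm_le_const (a := a) (b := b)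
    (f := fun x => f x - polyEval T.poly x) (C := T.err) fun x hx => by
      refine hf x (abs_le.2 ?_)
      have hx' := uIoc_subset_uIcc hx
      rw [mem_uIcc] at hx'
      rw [abs_le] at ha hb
      rcases hx' with h | h <;> constructor <;> linarith [h.1, h.2]
  refine h.trans ?_
  rw [mul_comm]
  refine mul_le_mul_of_nonneg_right ?_ h0
  rw [abs_le] at *
  constructor <;> linarith

theorem Encloses.integralToOne (hf : T.Encloses f) (hc : ContinuousOn f (Icc (-1) 1)) :
    T.integralToOne.Encloses fun x => ∫ y in x..1, f y := fun x hx => by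
  have hx' := abs_le.1 hx
  have h := hf.abs_integral_sub_le hx (abs_one.le)
    ((hc.mono (Icc_subset_Icc_left hx'.1)).intervalIntegrable_of_Icc hx'.2)
  have h1 := polyEval_ratCast (polyPrim T.poly) 1
  simp only [Rat.cast_one] at h1
  simp only [TaylorModel.integralToOne, polyEval_add, polyEval_scale, polyEval, ← h1]
  push_cast
  convert h using 2
  ring

theorem Encloses.abs_integral_le (hf : T.Encloses f) (hc : ContinuousOn f (Icc (-1) 1)) :
    |(∫ x in (-1 : ℝ)..1, f x) - T.integral| ≤ 2 * T.err := by
  have h := hf.abs_integral_sub_le (a := -1) (b := 1) (by simp) (by simp)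
    (hc.intervalIntegrable_of_Icc (by norm_num))
  have h1 := polyEval_ratCast (polyPrim T.poly) 1
  have h2 := polyEval_ratCast (polyPrim T.poly) (-1)
  push_cast at h1 h2
  simpa only [TaylorModel.integral, h1, h2, Rat.cast_sub] using h

theorem encloses_logOneAddDiv {c : ℚ} (hc : 1 < c) (n : ℕ) :
    (logOneAddDiv c n).Encloses fun x => Real.log (1 + x / c) := fun x hx => by
  have hc' : (1 : ℝ) < c := by exact_mod_cast hc
  have hc0 : (0 : ℝ) < c := by linarith
  have hxc : |-(x / c)| ≤ 1 / c := by
    rw [abs_neg, abs_div, abs_of_pos hc0]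
    gcongr
  have h1c : 1 / (c : ℝ) < 1 := (div_lt_one hc0).2 hc'
  have h := Real.abs_log_sub_add_sum_range_le (hxc.trans_lt h1c) n
  simp only [logOneAddDiv, polyEval, polyEval_map_range]
  push_cast
  have hsum : x * ∑ i ∈ Finset.range n, (-1) ^ i / (((i : ℝ) + 1) * (c : ℝ) ^ (i + 1)) * x ^ i =
      -∑ i ∈ Finset.range n, (-(x / c)) ^ (i + 1) / ((i : ℝ) + 1) := by
    rw [Finset.mul_sum, ← Finset.sum_neg_distrib]
    refine Finset.sum_congr rfl fun i _ => ?_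
    rw [neg_pow (x / c), div_pow, pow_succ (-1 : ℝ), pow_succ x]
    field_simp
  rw [hsum, zero_add, sub_neg_eq_add, add_comm]
  rw [sub_neg_eq_add] at h
  refine h.trans ?_
  have : 0 < 1 - 1 / (c : ℝ) := by linarith
  gcongr

theorem encloses_oneDivAdd {c : ℚ} (hc : 1 < c) (n : ℕ) :
    (oneDivAdd c n).Encloses fun x => 1 / (c + x) := fun x hx => by
  have hc' : (1 : ℝ) < c := by exact_mod_cast hc
  have hc0 : (0 : ℝ) < c := by linarith
  have hx' := abs_le.1 hx
  have hcx : 0 < (c : ℝ) + x := by linarith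
  simp only [oneDivAdd, polyEval_map_range]
  push_cast
  have hsum : ∑ i ∈ Finset.range n, (-1) ^ i / (c : ℝ) ^ (i + 1) * x ^ i =
      1 / (c + x) - (-(x / c)) ^ n / (c + x) := by
    induction n with
    | zero => simp
    | succ n ih =>
      rw [Finset.sum_range_succ, ih, neg_pow (x / c), neg_pow (x / c), div_pow, div_pow]
      field_simp
      ring
  rw [hsum, sub_sub_cancel, abs_div, abs_pow, abs_neg, abs_div, abs_of_pos hc0, abs_of_pos hcx]
  have : 0 < (c : ℝ) - 1 := by linarith
  gcongr
  linarith

end TaylorModel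

namespace TaylorModel

/-- The model of `x ↦ log (2 + x) / (3 + x)`. -/
def logKernelLeft : TaylorModel :=
  (((logOneAddDiv 2 33).constAt (-1)).scale (-1) |>.add (logOneAddDiv 2 33)).mul (oneDivAdd 3 21)

/-- The model of `x ↦ log (4 + x) / (5 + x)`. -/
def logKernelRight : TaylorModel :=
  (((logOneAddDiv 2 33).constAt (-1)).scale (-2) |>.add (logOneAddDiv 4 17)).mul (oneDivAdd 5 15)

/-- The model of `x ↦ log ((c + 1) / (c + x))`. -/
def logRatio (c : ℚ) (n : ℕ) : TaylorModel :=
  ((logOneAddDiv c n).constAt 1).add ((logOneAddDiv c n).scale (-1))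

/-- The model of `x ↦ ∫ y in x..1, log (6 / (5 + y)) / (4 + y)`. -/
def upperInner : TaylorModel := ((logRatio 5 13).mul (oneDivAdd 4 15)).integralToOne

/-- The model of the iterated integral in `f₃ 8`. -/
def lowerInner : TaylorModel :=
  ((((logRatio 7 9).mul (oneDivAdd 5 10)).integralToOne).mul (oneDivAdd 4 12)).integralToOne

/-- The model of `x ↦ log (7 / (4 + x))`. -/
def logSevenDiv : TaylorModel :=
  (((logOneAddDiv 2 33).constAt (-1)).scale (-1)).add
    (((logOneAddDiv 8 12).constAt (-1)).add ((logOneAddDiv 4 17).scale (-1)))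

/-- The model of the integrand of `F₃ 7` on the left half. -/
def upperLeft : TaylorModel := logKernelLeft.mul ((const 1).add upperInner)

/-- The model of the integrand of `f₃ 8` on the left half. -/
def lowerLeft : TaylorModel := logKernelLeft.mul (logSevenDiv.add lowerInner)

/-- The model of the integrand of `f₃ 8` on the right half. -/
def lowerRight : TaylorModel := logKernelRight.mul (logRatio 6 12)

end TaylorModel

theorem log_succ_sub_log_bounds {n : ℕ} (hn : 1 ≤ n) :
    (1 / (2 * (n : ℝ)) + 1 / (2 * (n + 1)) - (1 / (12 * (n : ℝ) ^ 2) - 1 / (12 * ((n : ℝ) + 1) ^ 2))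
      ≤ Real.log (n + 1) - Real.log n) ∧
    Real.log (n + 1) - Real.log n ≤
      1 / (2 * (n : ℝ)) + 1 / (2 * (n + 1)) - (1 / (12 * (n : ℝ) ^ 2) - 1 / (12 * ((n : ℝ) + 1) ^ 2))
      + (1 / (24 * (n : ℝ) ^ 4) - 1 / (24 * ((n : ℝ) + 1) ^ 4)) := by
  have hn' : (1 : ℝ) ≤ n := by exact_mod_cast hn
  generalize (n : ℝ) = x at hn'
  have hx : 0 < x := by linarith
  have h0 : 0 ≤ 1 / (2 * x + 1) := by positivity
  have h1 : 1 / (2 * x + 1) < 1 := by rw [div_lt_one (by positivity)]; linarith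
  have hlog : Real.log ((1 + 1 / (2 * x + 1)) / (1 - 1 / (2 * x + 1))) =
      Real.log (x + 1) - Real.log x := by
    rw [← Real.log_div (by positivity) (by positivity)]
    congr 1
    have : 2 * x + 1 - 1 ≠ 0 := by ring_nf; positivity
    field_simp
    ring
  have hl := Real.sum_range_le_log_div h0 h1 2
  have hu := Real.log_div_le_sum_range_add h0 h1 2
  rw [hlog] at hl hu
  simp only [Finset.sum_range_succ, Finset.sum_range_zero] at hl hu
  norm_num at hl hu
  constructor
  · have key : 1 / (2 * x) + 1 / (2 * (x + 1)) - (1 / (12 * x ^ 2) - 1 / (12 * (x + 1) ^ 2)) ≤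
        2 * ((2 * x + 1)⁻¹ + ((2 * x + 1) ^ 3)⁻¹ / 3) := by
      rw [← sub_nonneg]
      have : 2 * ((2 * x + 1)⁻¹ + ((2 * x + 1) ^ 3)⁻¹ / 3) -
          (1 / (2 * x) + 1 / (2 * (x + 1)) - (1 / (12 * x ^ 2) - 1 / (12 * (x + 1) ^ 2))) =
          (2 * x ^ 2 + 2 * x + 1) / (12 * x ^ 2 * (x + 1) ^ 2 * (2 * x + 1) ^ 3) := by
        field_simp
        ring
      rw [this]
      positivity
    linarith
  · have hz : 1 - ((2 * x + 1) ^ 2)⁻¹ = 4 * x * (x + 1) / (2 * x + 1) ^ 2 := by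
      field_simp
      ring
    rw [hz] at hu
    have key : 2 * ((2 * x + 1)⁻¹ + ((2 * x + 1) ^ 3)⁻¹ / 3 +
          ((2 * x + 1) ^ 5)⁻¹ / (4 * x * (x + 1) / (2 * x + 1) ^ 2)) ≤
        1 / (2 * x) + 1 / (2 * (x + 1)) - (1 / (12 * x ^ 2) - 1 / (12 * (x + 1) ^ 2)) +
          (1 / (24 * x ^ 4) - 1 / (24 * (x + 1) ^ 4)) := by
      rw [← sub_nonneg]
      obtain ⟨y, rfl⟩ : ∃ y, x = y + 1 := ⟨x - 1, by ring⟩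
      have hy : 0 ≤ y := by linarith
      field_simp
      ring_nf
      positivity
    linarith

/-- The truncation `H_n - log n - 1 / (2 n) + 1 / (12 n²)` of the asymptotic expansion of the
Euler–Mascheroni constant. -/
noncomputable def eulerMascheroniApprox (n : ℕ) : ℝ :=
  harmonic n - Real.log n - 1 / (2 * n) + 1 / (12 * (n : ℝ) ^ 2)

theorem tendsto_eulerMascheroniApprox :
    Filter.Tendsto eulerMascheroniApprox Filter.atTop (nhds Real.eulerMascheroniConstant) := by
  have h1 : Filter.Tendsto (fun n : ℕ => (1 : ℝ) / n) Filter.atTop (nhds 0) :=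
    tendsto_one_div_atTop_nhds_zero_nat
  have h := (Real.tendsto_harmonic_sub_log.sub (h1.const_mul (1 / 2))).add
    ((h1.pow 2).const_mul (1 / 12))
  norm_num at h
  refine h.congr fun n => ?_
  rw [eulerMascheroniApprox]
  rcases eq_or_ne n 0 with rfl | hn
  · simp
  · field_simp

theorem eulerMascheroniConstant_le_approx {n : ℕ} (hn : 1 ≤ n) :
    Real.eulerMascheroniConstant ≤ eulerMascheroniApprox n := by
  have hanti : Antitone fun k => eulerMascheroniApprox (k + n) := by
    refine antitone_nat_of_succ_le fun k => ?_
    have h := (log_succ_sub_log_bounds (n := k + n) (by omega)).1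
    simp only [eulerMascheroniApprox]
    rw [show k + 1 + n = (k + n) + 1 by ring, harmonic_succ]
    push_cast at h ⊢
    have : ((k : ℝ) + n + 1)⁻¹ = 2 * (1 / (2 * ((k : ℝ) + n + 1))) := by field_simp
    linarith
  simpa using hanti.le_of_tendsto
    (tendsto_eulerMascheroniApprox.comp (Filter.tendsto_add_atTop_nat n)) 0

theorem approx_sub_le_eulerMascheroniConstant {n : ℕ} (hn : 1 ≤ n) :
    eulerMascheroniApprox n - 1 / (24 * (n : ℝ) ^ 4) ≤ Real.eulerMascheroniConstant := by
  have hmono : Monotone fun k : ℕ =>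
      eulerMascheroniApprox (k + n) - 1 / (24 * ((k + n : ℕ) : ℝ) ^ 4) := by
    refine monotone_nat_of_le_succ fun k => ?_
    have h := (log_succ_sub_log_bounds (n := k + n) (by omega)).2
    simp only [eulerMascheroniApprox]
    rw [show k + 1 + n = (k + n) + 1 by ring, harmonic_succ]
    push_cast at h ⊢
    have : ((k : ℝ) + n + 1)⁻¹ = 2 * (1 / (2 * ((k : ℝ) + n + 1))) := by field_simp
    linarith
  have hlim : Filter.Tendsto (fun n : ℕ => eulerMascheroniApprox n - 1 / (24 * (n : ℝ) ^ 4))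
      Filter.atTop (nhds Real.eulerMascheroniConstant) := by
    have h1 : Filter.Tendsto (fun n : ℕ => (1 : ℝ) / n) Filter.atTop (nhds 0) :=
      tendsto_one_div_atTop_nhds_zero_nat
    have h := tendsto_eulerMascheroniApprox.sub ((h1.pow 4).const_mul (1 / 24))
    norm_num at h
    refine h.congr fun n => ?_
    rcases eq_or_ne n 0 with rfl | hn
    · simp
    · field_simp
  simpa using hmono.ge_of_tendsto (hlim.comp (Filter.tendsto_add_atTop_nat n)) 0

theorem hasDerivAt_integral_left {g : ℝ → ℝ} {c b x : ℝ} (hg : ContinuousOn g (Ioi c))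
    (hx : c < x) (hb : c < b) : HasDerivAt (fun y => ∫ t in y..b, g t) (-g x) x := by
  refine intervalIntegral.integral_hasDerivAt_left ?_ ?_ (hg.continuousAt (Ioi_mem_nhds hx))
  · refine (hg.mono fun y hy => ?_).intervalIntegrable
    rw [mem_uIcc] at hy
    rcases hy with h | h
    · exact hx.trans_le h.1
    · exact hb.trans_le h.1
  · exact hg.stronglyMeasurableAtFilter isOpen_Ioi x hx

theorem integral_log_div_mul_eq {v v' : ℝ → ℝ} {x : ℝ} (hx : |x| ≤ 1)
    (hv : ∀ y ∈ Icc (-1 : ℝ) 1, HasDerivAt v (-v' y) y) (hv' : ContinuousOn v' (Icc (-1) 1))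
    (hv1 : v 1 = 0) :
    ∫ y in x..1, Real.log ((4 + y) / (4 + x)) * v' y = ∫ y in x..1, v y / (4 + y) := by
  obtain ⟨hx0, hx1⟩ := abs_le.1 hx
  have hsub : uIcc x 1 ⊆ Icc (-1) 1 := by rw [uIcc_of_le hx1]; exact Icc_subset_Icc_left hx0
  have h := intervalIntegral.integral_mul_deriv_eq_deriv_mul (a := x) (b := 1)
    (u := fun y => Real.log ((4 + y) / (4 + x))) (u' := fun y => 1 / (4 + y)) (v := v)
    (v' := fun y => -v' y) (fun y hy => ?_) (fun y hy => hv y (hsub hy)) ?_ ?_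
  · simp only [mul_neg, intervalIntegral.integral_neg, hv1, mul_zero] at h
    rw [div_self (by linarith), Real.log_one, zero_mul, sub_self, zero_sub, neg_inj] at h
    rw [h]
    exact intervalIntegral.integral_congr fun y _ => one_div_mul_eq_div _ _
  · have hy0 := (hsub hy).1
    have h4x : 4 + x ≠ 0 := by linarith
    have h4y : 4 + y ≠ 0 := by linarith
    refine ((((hasDerivAt_id y).const_add 4).div_const (4 + x)).log
      (div_ne_zero h4y h4x)).congr_deriv ?_
    simp only [id]
    field_simp
  · refine (ContinuousOn.div continuousOn_const (by fun_prop) fun y hy => ?_).intervalIntegrable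
    linarith [(hsub hy).1]
  · exact (hv'.mono hsub).neg.intervalIntegrable

theorem upper_inner_eq {x : ℝ} (hx : |x| ≤ 1) :
    ∫ u in (x + 3 + 2)..(7 - 1), (1 / u) * Real.log ((u - 1) / (x + 3 + 1)) =
      ∫ y in x..1, Real.log (6 / (5 + y)) / (4 + y) := by
  rw [← integral_log_div_mul_eq (v := fun y => Real.log (6 / (5 + y)))
    (v' := fun y => 1 / (5 + y)) hx]
  · have h := intervalIntegral.integral_comp_add_right (a := x) (b := 1)
      (fun u => (1 / u) * Real.log ((u - 1) / (x + 3 + 1))) 5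
    rw [show x + 3 + 2 = x + 5 by ring, show (7 : ℝ) - 1 = 1 + 5 by norm_num, ← h]
    refine intervalIntegral.integral_congr fun y _ => ?_
    rw [show y + 5 - 1 = 4 + y by ring, show x + 3 + 1 = 4 + x by ring, add_comm y 5, mul_comm]
  · intro y hy
    have h5 : 5 + y ≠ 0 := by linarith [hy.1]
    refine (((((hasDerivAt_id y).const_add 5).inv h5).const_mul 6).log ?_).congr_deriv ?_
    · exact mul_ne_zero (by norm_num) (inv_ne_zero h5)
    · simp only [id, Pi.inv_apply]
      field_simp
  · refine ContinuousOn.div continuousOn_const (by fun_prop) fun y hy => ?_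
    linarith [hy.1]
  · norm_num

theorem continuousOn_log_eight_div :
    ContinuousOn (fun y : ℝ => Real.log (8 / (7 + y)) / (5 + y)) (Ioi (-5)) := by
  refine ContinuousOn.div (ContinuousOn.log (ContinuousOn.div continuousOn_const (by fun_prop)
    fun y hy => ?_) fun y hy => div_ne_zero (by norm_num) ?_) (by fun_prop) fun y hy => ?_
  all_goals have := mem_Ioi.1 hy; linarith

theorem lower_inner_eq {x : ℝ} (hx : |x| ≤ 1) :
    ∫ u in (x + 3 + 2)..(8 - 2),
        (1 / u) * Real.log ((u - 1) / (x + 3 + 1)) * Real.log (8 / (u + 2)) =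
      ∫ y in x..1, (∫ z in y..1, Real.log (8 / (7 + z)) / (5 + z)) / (4 + y) := by
  rw [← integral_log_div_mul_eq (v := fun y => ∫ z in y..1, Real.log (8 / (7 + z)) / (5 + z))
    (v' := fun y => Real.log (8 / (7 + y)) / (5 + y)) hx]
  · have h := intervalIntegral.integral_comp_add_right (a := x) (b := 1)
      (fun u => (1 / u) * Real.log ((u - 1) / (x + 3 + 1)) * Real.log (8 / (u + 2))) 5
    rw [show x + 3 + 2 = x + 5 by ring, show (8 : ℝ) - 2 = 1 + 5 by norm_num, ← h]
    refine intervalIntegral.integral_congr fun y _ => ?_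
    rw [show y + 5 - 1 = 4 + y by ring, show x + 3 + 1 = 4 + x by ring,
      show y + 5 + 2 = 7 + y by ring, add_comm y 5]
    ring
  · intro y hy
    exact hasDerivAt_integral_left continuousOn_log_eight_div (by linarith [hy.1]) (by norm_num)
  · exact continuousOn_log_eight_div.mono fun y hy => by
      rw [mem_Ioi]; linarith [hy.1]
  · simp

theorem integral_log_sub_one_div_eq :
    ∫ t in (3 : ℝ)..(8 - 1), (1 / t) * ∫ u in (2 : ℝ)..(t - 1), Real.log (u - 1) / u =
      ∫ t in (2 : ℝ)..6, Real.log (t - 1) / t * Real.log (7 / (t + 1)) := by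
  have hcont : ContinuousOn (fun u : ℝ => Real.log (u - 1) / u) (Ioi 1) := by
    refine ContinuousOn.div (ContinuousOn.log (by fun_prop) fun y hy => ?_) (by fun_prop)
      fun y hy => ?_
    all_goals have := mem_Ioi.1 hy; linarith
  have hpos : ∀ t ∈ uIcc (2 : ℝ) 6, 2 ≤ t := fun t ht => by
    rw [uIcc_of_le (by norm_num)] at ht
    exact ht.1
  have h := intervalIntegral.integral_mul_deriv_eq_deriv_mul (a := 2) (b := 6)
    (u := fun t => ∫ u in (2 : ℝ)..t, Real.log (u - 1) / u)
    (u' := fun t => Real.log (t - 1) / t) (v := fun t => Real.log (7 / (t + 1)))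
    (v' := fun t => -(1 / (t + 1))) (fun t ht => ?_) (fun t ht => ?_) ?_ ?_
  · simp only [mul_neg, intervalIntegral.integral_neg, intervalIntegral.integral_same] at h
    rw [show (7 : ℝ) / (6 + 1) = 1 by norm_num, Real.log_one, mul_zero, zero_mul, sub_zero,
      zero_sub, neg_inj] at h
    rw [← h]
    have hs := intervalIntegral.integral_comp_add_right (a := 2) (b := 6)
      (fun t => (1 / t) * ∫ u in (2 : ℝ)..(t - 1), Real.log (u - 1) / u) 1
    rw [show (3 : ℝ) = 2 + 1 by norm_num, show (8 : ℝ) - 1 = 6 + 1 by norm_num, ← hs]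
    refine intervalIntegral.integral_congr fun t _ => ?_
    rw [add_sub_cancel_right, mul_comm]
  · have := hpos t ht
    have h := (hasDerivAt_integral_left (b := 2) hcont (show 1 < t by linarith)
      (by norm_num)).neg
    simp only [neg_neg] at h
    refine h.congr_of_eventuallyEq (Filter.Eventually.of_forall fun y => ?_)
    exact intervalIntegral.integral_symm _ _
  · have h1 : t + 1 ≠ 0 := by linarith [hpos t ht]
    refine (((((hasDerivAt_id t).add_const 1).inv h1).const_mul 7).log ?_).congr_deriv ?_
    · exact mul_ne_zero (by norm_num) (inv_ne_zero h1)
    · simp only [id, Pi.inv_apply]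
      field_simp
  · refine (hcont.mono fun t ht => ?_).intervalIntegrable
    rw [mem_Ioi]
    linarith [hpos t ht]
  · refine (ContinuousOn.neg (ContinuousOn.div continuousOn_const (by fun_prop)
      fun t ht => ?_)).intervalIntegrable
    linarith [hpos t ht]

namespace TaylorModel

theorem encloses_log_half : ((logOneAddDiv 2 33).constAt (-1)).Encloses
    fun _ => -Real.log 2 :=
  ((encloses_logOneAddDiv (by norm_num) 33).constAt (-1) (by norm_num)).congr fun x _ => by
    rw [← Real.log_inv]
    norm_num

theorem encloses_log_two_add : (((logOneAddDiv 2 33).constAt (-1)).scale (-1) |>.add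
    (logOneAddDiv 2 33)).Encloses fun x => Real.log (2 + x) :=
  ((encloses_log_half.scale (-1)).add (encloses_logOneAddDiv (by norm_num) 33)).congr
    fun x hx => by
      have := (abs_le.1 hx).1
      rw [show 2 + x = 2 * (1 + x / 2) by ring, Real.log_mul (by norm_num) (by linarith)]
      push_cast
      ring

theorem encloses_log_four_add : (((logOneAddDiv 2 33).constAt (-1)).scale (-2) |>.add
    (logOneAddDiv 4 17)).Encloses fun x => Real.log (4 + x) :=
  ((encloses_log_half.scale (-2)).add (encloses_logOneAddDiv (by norm_num) 17)).congr
    fun x hx => by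
      have := (abs_le.1 hx).1
      rw [show 4 + x = 2 * (2 * (1 + x / 4)) by ring, Real.log_mul (by norm_num) (by linarith),
        Real.log_mul (by norm_num) (by linarith)]
      push_cast
      ring

theorem encloses_logKernelLeft :
    logKernelLeft.Encloses fun x => Real.log (2 + x) / (3 + x) :=
  (encloses_log_two_add.mul (encloses_oneDivAdd (by norm_num) 21)).congr fun x _ => by
    push_cast
    exact div_eq_mul_one_div _ _

theorem encloses_logKernelRight :
    logKernelRight.Encloses fun x => Real.log (4 + x) / (5 + x) :=
  (encloses_log_four_add.mul (encloses_oneDivAdd (by norm_num) 15)).congr fun x _ => by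
    push_cast
    exact div_eq_mul_one_div _ _

theorem encloses_logRatio {c : ℚ} (hc : 1 < c) (n : ℕ) :
    (logRatio c n).Encloses fun x => Real.log ((c + 1) / (c + x)) :=
  (((encloses_logOneAddDiv hc n).constAt 1 (by norm_num)).add
    ((encloses_logOneAddDiv hc n).scale (-1))).congr fun x hx => by
      have hc' : (1 : ℝ) < c := by exact_mod_cast hc
      have := (abs_le.1 hx).1
      have h1 : (c : ℝ) + 1 ≠ 0 := by linarith
      have h2 : (c : ℝ) + x ≠ 0 := by linarith
      have h3 : (c : ℝ) ≠ 0 := by linarith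
      have e1 : 1 + ((1 : ℚ) : ℝ) / c = (c + 1) / c := by push_cast; field_simp
      have e2 : 1 + x / c = (c + x) / c := by field_simp
      rw [e1, e2, Real.log_div h1 h2, Real.log_div h1 h3, Real.log_div h2 h3]
      push_cast
      ring

theorem encloses_upperInner :
    upperInner.Encloses fun x => ∫ y in x..1, Real.log (6 / (5 + y)) / (4 + y) := by
  refine Encloses.integralToOne (((encloses_logRatio (by norm_num) 13).mul
    (encloses_oneDivAdd (by norm_num) 15)).congr fun x _ => ?_) ?_
  · push_cast
    rw [div_eq_mul_one_div]
    norm_num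
  · refine ContinuousOn.div (ContinuousOn.log (ContinuousOn.div continuousOn_const (by fun_prop)
      fun y hy => ?_) fun y hy => div_ne_zero (by norm_num) ?_) (by fun_prop) fun y hy => ?_
    all_goals linarith [hy.1]

theorem continuousOn_integral_log_eight_div :
    ContinuousOn (fun y => ∫ z in y..1, Real.log (8 / (7 + z)) / (5 + z)) (Ioi (-5)) :=
  fun y hy => (hasDerivAt_integral_left continuousOn_log_eight_div hy
    (by norm_num)).continuousAt.continuousWithinAt

theorem encloses_lowerInner : lowerInner.Encloses fun x =>
    ∫ y in x..1, (∫ z in y..1, Real.log (8 / (7 + z)) / (5 + z)) / (4 + y) := by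
  have hsub : Icc (-1 : ℝ) 1 ⊆ Ioi (-5) := fun y hy => by rw [mem_Ioi]; linarith [hy.1]
  refine Encloses.integralToOne ((Encloses.mul (Encloses.integralToOne
    (f := fun z => Real.log (8 / (7 + z)) / (5 + z)) (((encloses_logRatio (by norm_num) 9).mul
    (encloses_oneDivAdd (by norm_num) 10)).congr fun x _ => ?_) ?_)
    (encloses_oneDivAdd (by norm_num) 12)).congr fun x _ => ?_) ?_
  · push_cast
    rw [div_eq_mul_one_div]
    norm_num
  · exact continuousOn_log_eight_div.mono hsub
  · push_cast
    exact div_eq_mul_one_div _ _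
  · refine (continuousOn_integral_log_eight_div.mono hsub).div (by fun_prop) fun y hy => ?_
    linarith [hy.1]

theorem encloses_log_seven_eighths : ((logOneAddDiv 8 12).constAt (-1)).Encloses
    fun _ => Real.log 7 - 3 * Real.log 2 :=
  ((encloses_logOneAddDiv (by norm_num) 12).constAt (-1) (by norm_num)).congr fun x _ => by
    have h : Real.log 8 = 3 * Real.log 2 := by
      rw [show (8 : ℝ) = 2 ^ 3 by norm_num, Real.log_pow]
      norm_num
    rw [← h, ← Real.log_div (by norm_num) (by norm_num)]
    norm_num

theorem encloses_logSevenDiv : logSevenDiv.Encloses fun x => Real.log (7 / (4 + x)) :=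
  ((encloses_log_half.scale (-1)).add (encloses_log_seven_eighths.add
    ((encloses_logOneAddDiv (by norm_num) 17).scale (-1)))).congr fun x hx => by
      have := (abs_le.1 hx).1
      rw [show 4 + x = 2 * (2 * (1 + x / 4)) by ring, Real.log_div (by norm_num) (by linarith),
        Real.log_mul (by norm_num) (by linarith), Real.log_mul (by norm_num) (by linarith)]
      push_cast
      ring

theorem encloses_upperLeft : upperLeft.Encloses fun x => Real.log (2 + x) / (3 + x) *
    (1 + ∫ y in x..1, Real.log (6 / (5 + y)) / (4 + y)) :=
  (encloses_logKernelLeft.mul ((encloses_const 1).add encloses_upperInner)).congr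
    fun x _ => by push_cast; rfl

theorem encloses_lowerLeft : lowerLeft.Encloses fun x => Real.log (2 + x) / (3 + x) *
    (Real.log (7 / (4 + x)) +
      ∫ y in x..1, (∫ z in y..1, Real.log (8 / (7 + z)) / (5 + z)) / (4 + y)) :=
  encloses_logKernelLeft.mul (encloses_logSevenDiv.add encloses_lowerInner)

theorem encloses_lowerRight : lowerRight.Encloses fun x =>
    Real.log (4 + x) / (5 + x) * Real.log (7 / (6 + x)) :=
  (encloses_logKernelRight.mul (encloses_logRatio (by norm_num) 12)).congr fun x _ => by
    push_cast
    norm_num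

theorem upper_integral_le : upperLeft.integral + 2 * upperLeft.err +
    (logKernelRight.integral + 2 * logKernelRight.err) ≤ 0.965118009 := by
  decide +kernel

theorem le_lower_integral : 0.29984879 ≤ lowerLeft.integral - 2 * lowerLeft.err +
    (lowerRight.integral - 2 * lowerRight.err) := by
  decide +kernel

end TaylorModel

open TaylorModel

theorem log_two_bounds : 0.69314718044 ≤ Real.log 2 ∧ Real.log 2 ≤ 0.69314718068 := by
  have h := encloses_log_half 0 (by simp)
  have h1 : 0.69314718044 ≤ -polyEvalRat (logOneAddDiv 2 33).poly (-1) - (logOneAddDiv 2 33).err ∧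
      -polyEvalRat (logOneAddDiv 2 33).poly (-1) + (logOneAddDiv 2 33).err ≤ 0.69314718068 := by
    decide +kernel
  have h2 := (Rat.cast_le (K := ℝ)).2 h1.1
  have h3 := (Rat.cast_le (K := ℝ)).2 h1.2
  simp only [constAt, polyEval, zero_mul, add_zero] at h
  push_cast at h2 h3
  rw [abs_le] at h
  constructor <;> linarith [h.1, h.2]

theorem log_seven_ge : 1.945910148 ≤ Real.log 7 := by
  have h := (abs_le.1 (encloses_log_seven_eighths 0 (by simp))).1
  have h1 : -0.1335313927 ≤ polyEvalRat (logOneAddDiv 8 12).poly (-1) - (logOneAddDiv 8 12).err := by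
    decide +kernel
  have h2 := (Rat.cast_le (K := ℝ)).2 h1
  simp only [constAt, polyEval, zero_mul, add_zero] at h
  push_cast at h2
  linarith [log_two_bounds.1]

theorem log_sixty_four : Real.log 64 = 6 * Real.log 2 := by
  rw [show (64 : ℝ) = 2 ^ 6 by norm_num, Real.log_pow]
  norm_num

theorem eulerMascheroniConstant_le : Real.eulerMascheroniConstant ≤ 0.5772156665 := by
  have h := eulerMascheroniConstant_le_approx (n := 64) (by norm_num)
  have h1 : harmonic 64 ≤ 4.743890903706 := by
    norm_num [harmonic, Finset.sum_range_succ]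
  have h2 := (Rat.cast_le (K := ℝ)).2 h1
  rw [eulerMascheroniApprox] at h
  push_cast at h h2
  rw [log_sixty_four] at h
  linarith [log_two_bounds.1]

theorem le_eulerMascheroniConstant : 0.57721566 ≤ Real.eulerMascheroniConstant := by
  have h := approx_sub_le_eulerMascheroniConstant (n := 64) (by norm_num)
  have h1 : 4.743890903705 ≤ harmonic 64 := by
    norm_num [harmonic, Finset.sum_range_succ]
  have h2 := (Rat.cast_le (K := ℝ)).2 h1
  rw [eulerMascheroniApprox] at h
  push_cast at h h2
  rw [log_sixty_four] at h
  linarith [log_two_bounds.2]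

theorem exp_eulerMascheroniConstant_le :
    Real.exp Real.eulerMascheroniConstant ≤ 1.781072421 := by
  refine (Real.exp_le_exp.2 eulerMascheroniConstant_le).trans ?_
  refine (Real.exp_bound' (by norm_num) (by norm_num) (n := 12) (by norm_num)).trans ?_
  norm_num [Finset.sum_range_succ, Nat.factorial]

theorem le_exp_eulerMascheroniConstant :
    1.781072408 ≤ Real.exp Real.eulerMascheroniConstant := by
  refine le_trans ?_ (Real.exp_le_exp.2 le_eulerMascheroniConstant)
  refine le_trans ?_ (Real.sum_le_exp_of_nonneg (by norm_num) 12)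
  norm_num [Finset.sum_range_succ, Nat.factorial]

theorem continuousOn_log_two_add_div :
    ContinuousOn (fun x : ℝ => Real.log (2 + x) / (3 + x)) (Icc (-1) 1) := by
  refine ContinuousOn.div (ContinuousOn.log (by fun_prop) fun x hx => ?_) (by fun_prop)
    fun x hx => ?_
  all_goals linarith [hx.1]

theorem continuousOn_log_four_add_div :
    ContinuousOn (fun x : ℝ => Real.log (4 + x) / (5 + x)) (Icc (-1) 1) := by
  refine ContinuousOn.div (ContinuousOn.log (by fun_prop) fun x hx => ?_) (by fun_prop)
    fun x hx => ?_
  all_goals linarith [hx.1]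

theorem continuousOn_log_div_add (a c : ℝ) (ha : 0 < a) (hc : 1 < c) :
    ContinuousOn (fun x : ℝ => Real.log (a / (c + x))) (Icc (-1) 1) := by
  refine ContinuousOn.log (ContinuousOn.div continuousOn_const (by fun_prop) fun x hx => ?_)
    fun x hx => div_ne_zero ha.ne' ?_
  all_goals linarith [hx.1]

theorem continuousOn_upper_inner : ContinuousOn
    (fun x : ℝ => ∫ y in x..1, Real.log (6 / (5 + y)) / (4 + y)) (Icc (-1) 1) := by
  have h : ContinuousOn (fun y : ℝ => Real.log (6 / (5 + y)) / (4 + y)) (Ioi (-4)) := by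
    refine ContinuousOn.div (ContinuousOn.log (ContinuousOn.div continuousOn_const (by fun_prop)
      fun y hy => ?_) fun y hy => div_ne_zero (by norm_num) ?_) (by fun_prop) fun y hy => ?_
    all_goals have := mem_Ioi.1 hy; linarith
  exact fun x hx => (hasDerivAt_integral_left h (by linarith [hx.1])
    (by norm_num)).continuousAt.continuousWithinAt

theorem continuousOn_lower_inner : ContinuousOn
    (fun x : ℝ => ∫ y in x..1, (∫ z in y..1, Real.log (8 / (7 + z)) / (5 + z)) / (4 + y))
    (Icc (-1) 1) := by
  have h : ContinuousOn
      (fun y : ℝ => (∫ z in y..1, Real.log (8 / (7 + z)) / (5 + z)) / (4 + y)) (Ioi (-4)) := by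
    refine ContinuousOn.div (continuousOn_integral_log_eight_div.mono
      (Ioi_subset_Ioi (by norm_num))) (by fun_prop) fun y hy => ?_
    have := mem_Ioi.1 hy
    linarith
  exact fun x hx => (hasDerivAt_integral_left h (by linarith [hx.1])
    (by norm_num)).continuousAt.continuousWithinAt

theorem integral_two_four_eq (g : ℝ → ℝ) :
    ∫ t in (2 : ℝ)..4, g t = ∫ x in (-1 : ℝ)..1, g (x + 3) := by
  rw [intervalIntegral.integral_comp_add_right]
  norm_num

theorem integral_two_six_eq {g : ℝ → ℝ} (hg : ContinuousOn g (Icc 2 6)) :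
    ∫ t in (2 : ℝ)..6, g t =
      (∫ x in (-1 : ℝ)..1, g (x + 3)) + ∫ x in (-1 : ℝ)..1, g (x + 5) := by
  rw [← integral_two_four_eq, intervalIntegral.integral_comp_add_right,
    show (-1 : ℝ) + 5 = 4 by norm_num, show (1 : ℝ) + 5 = 6 by norm_num,
    intervalIntegral.integral_add_adjacent_intervals]
  · exact (hg.mono (Icc_subset_Icc_right (by norm_num))).intervalIntegrable_of_Icc (by norm_num)
  · exact (hg.mono (Icc_subset_Icc_left (by norm_num))).intervalIntegrable_of_Icc (by norm_num)

theorem continuousOn_log_sub_one_div :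
    ContinuousOn (fun t : ℝ => Real.log (t - 1) / t) (Icc 2 6) := by
  refine ContinuousOn.div (ContinuousOn.log (by fun_prop) fun x hx => ?_) (by fun_prop)
    fun x hx => ?_
  all_goals linarith [hx.1]

theorem abs_le_one_of_mem_uIcc {x : ℝ} (hx : x ∈ uIcc (-1 : ℝ) 1) : |x| ≤ 1 := by
  rw [uIcc_of_le (by norm_num)] at hx
  exact abs_le.2 hx

theorem F₃_seven_integrals_le :
    (∫ t in (2:ℝ)..(7 - 1), Real.log (t - 1) / t)
      + (∫ t in (2:ℝ)..(7 - 3), (Real.log (t - 1) / t) *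
          ∫ u in (t + 2)..(7 - 1), (1 / u) * Real.log ((u - 1) / (t + 1))) ≤ 0.965118009 := by
  have hA : ∫ t in (2:ℝ)..(7 - 1), Real.log (t - 1) / t =
      (∫ x in (-1 : ℝ)..1, Real.log (2 + x) / (3 + x)) +
        ∫ x in (-1 : ℝ)..1, Real.log (4 + x) / (5 + x) := by
    rw [show (7 : ℝ) - 1 = 6 by norm_num, integral_two_six_eq continuousOn_log_sub_one_div]
    congr 1 <;> refine intervalIntegral.integral_congr fun x _ => ?_ <;> ring_nf
  have hB : ∫ t in (2:ℝ)..(7 - 3), (Real.log (t - 1) / t) *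
        ∫ u in (t + 2)..(7 - 1), (1 / u) * Real.log ((u - 1) / (t + 1)) =
      ∫ x in (-1 : ℝ)..1, Real.log (2 + x) / (3 + x) *
        ∫ y in x..1, Real.log (6 / (5 + y)) / (4 + y) := by
    rw [show (7 : ℝ) - 3 = 4 by norm_num, integral_two_four_eq]
    refine intervalIntegral.integral_congr fun x hx => ?_
    rw [upper_inner_eq (abs_le_one_of_mem_uIcc hx), show x + 3 - 1 = 2 + x by ring, add_comm x 3]
  have hc := continuousOn_log_two_add_div
  have hc' := continuousOn_log_two_add_div.mul continuousOn_upper_inner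
  have hsum : (∫ x in (-1 : ℝ)..1, Real.log (2 + x) / (3 + x)) +
      (∫ x in (-1 : ℝ)..1, Real.log (2 + x) / (3 + x) *
        ∫ y in x..1, Real.log (6 / (5 + y)) / (4 + y)) =
      ∫ x in (-1 : ℝ)..1, Real.log (2 + x) / (3 + x) *
        (1 + ∫ y in x..1, Real.log (6 / (5 + y)) / (4 + y)) := by
    simp only [mul_add, mul_one]
    exact (intervalIntegral.integral_add (hc.intervalIntegrable_of_Icc (by norm_num))
      (hc'.intervalIntegrable_of_Icc (by norm_num))).symm
  have h1 := (abs_le.1 (encloses_upperLeft.abs_integral_le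
    (hc.mul (continuousOn_const.add continuousOn_upper_inner)))).2
  have h2 := (abs_le.1 (encloses_logKernelRight.abs_integral_le
    continuousOn_log_four_add_div)).2
  have h3 := (Rat.cast_le (K := ℝ)).2 upper_integral_le
  push_cast at h3
  rw [hA, hB]
  linarith

theorem le_f₃_eight_integrals :
    0.29984879 ≤
      (∫ t in (3:ℝ)..(8 - 1), (1 / t) * ∫ u in (2:ℝ)..(t - 1), Real.log (u - 1) / u)
      + ∫ t in (2:ℝ)..(8 - 4), (Real.log (t - 1) / t) *
          ∫ u in (t + 2)..(8 - 2),
            (1 / u) * Real.log ((u - 1) / (t + 1)) * Real.log (8 / (u + 2)) := by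
  have hC : ∫ t in (3:ℝ)..(8 - 1), (1 / t) * ∫ u in (2:ℝ)..(t - 1), Real.log (u - 1) / u =
      (∫ x in (-1 : ℝ)..1, Real.log (2 + x) / (3 + x) * Real.log (7 / (4 + x))) +
        ∫ x in (-1 : ℝ)..1, Real.log (4 + x) / (5 + x) * Real.log (7 / (6 + x)) := by
    rw [integral_log_sub_one_div_eq, integral_two_six_eq]
    · congr 1 <;> refine intervalIntegral.integral_congr fun x _ => ?_ <;> ring_nf
    · refine continuousOn_log_sub_one_div.mul (ContinuousOn.log (ContinuousOn.div
        continuousOn_const (by fun_prop) fun x hx => ?_) fun x hx => div_ne_zero (by norm_num) ?_)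
      all_goals linarith [hx.1]
  have hD : ∫ t in (2:ℝ)..(8 - 4), (Real.log (t - 1) / t) * ∫ u in (t + 2)..(8 - 2),
        (1 / u) * Real.log ((u - 1) / (t + 1)) * Real.log (8 / (u + 2)) =
      ∫ x in (-1 : ℝ)..1, Real.log (2 + x) / (3 + x) *
        ∫ y in x..1, (∫ z in y..1, Real.log (8 / (7 + z)) / (5 + z)) / (4 + y) := by
    rw [show (8 : ℝ) - 4 = 4 by norm_num, integral_two_four_eq]
    refine intervalIntegral.integral_congr fun x hx => ?_
    rw [lower_inner_eq (abs_le_one_of_mem_uIcc hx), show x + 3 - 1 = 2 + x by ring, add_comm x 3]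
  have hlog := continuousOn_log_div_add 7 4 (by norm_num) (by norm_num)
  have hc := continuousOn_log_two_add_div.mul hlog
  have hc' := continuousOn_log_two_add_div.mul continuousOn_lower_inner
  have hsum : (∫ x in (-1 : ℝ)..1, Real.log (2 + x) / (3 + x) * Real.log (7 / (4 + x))) +
      (∫ x in (-1 : ℝ)..1, Real.log (2 + x) / (3 + x) *
        ∫ y in x..1, (∫ z in y..1, Real.log (8 / (7 + z)) / (5 + z)) / (4 + y)) =
      ∫ x in (-1 : ℝ)..1, Real.log (2 + x) / (3 + x) * (Real.log (7 / (4 + x)) +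
        ∫ y in x..1, (∫ z in y..1, Real.log (8 / (7 + z)) / (5 + z)) / (4 + y)) := by
    simp only [mul_add]
    exact (intervalIntegral.integral_add (hc.intervalIntegrable_of_Icc (by norm_num))
      (hc'.intervalIntegrable_of_Icc (by norm_num))).symm
  have h1 := (abs_le.1 (encloses_lowerLeft.abs_integral_le
    (continuousOn_log_two_add_div.mul (hlog.add continuousOn_lower_inner)))).1
  have h2 := (abs_le.1 (encloses_lowerRight.abs_integral_le
    (continuousOn_log_four_add_div.mul
      (continuousOn_log_div_add 7 6 (by norm_num) (by norm_num))))).1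
  have h3 := (Rat.cast_le (K := ℝ)).2 le_lower_integral
  push_cast at h3
  rw [hC, hD]
  linarith

theorem stmt8 : F₃ 7 ≤ 1.0000050 ∧ 0.9999648 ≤ f₃ 8 := by
  constructor
  · have h1 := F₃_seven_integrals_le
    have h2 := exp_eulerMascheroniConstant_le
    have h0 := Real.exp_pos Real.eulerMascheroniConstant
    rw [F₃, add_assoc]
    calc _ ≤ 2 * Real.exp Real.eulerMascheroniConstant / 7 * (1 + 0.965118009) := by gcongr
      _ ≤ 2 * 1.781072421 / 7 * (1 + 0.965118009) := by gcongr
      _ ≤ 1.0000050 := by norm_num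
  · have h1 := le_f₃_eight_integrals
    have h2 := le_exp_eulerMascheroniConstant
    have h3 := log_seven_ge
    have h0 := Real.exp_pos Real.eulerMascheroniConstant
    rw [f₃, add_assoc, show (8 : ℝ) - 1 = 7 by norm_num] at *
    calc (0.9999648 : ℝ) ≤ 2 * 1.781072408 / 8 * (1.945910148 + 0.29984879) := by norm_num
      _ ≤ 2 * Real.exp Real.eulerMascheroniConstant / 8 * (1.945910148 + 0.29984879) := by gcongr
      _ ≤ _ := by gcongr
end

section
/- One has ∫₃^{5.6} (1/t) (1/(6.6−t) − 1/5.6) (∫₂^{t−1} (log(u−1)/u) du) dt < 0.05558. -/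
open Finset in
/-- Taylor polynomials of odd degree bound `log (1 + z)` from above. -/
lemma log_one_add_le_sum_of_odd {n : ℕ} (hn : Odd n) {z : ℝ} (hz : -1 < z) :
    Real.log (1 + z) ≤ ∑ i ∈ range n, (-1) ^ i * z ^ (i + 1) / ((i : ℝ) + 1) := by
  set g : ℝ → ℝ := fun z ↦
    ∑ i ∈ range n, (-1) ^ i * z ^ (i + 1) / ((i : ℝ) + 1) - Real.log (1 + z) with hg
  have hder : ∀ y : ℝ, -1 < y → HasDerivAt g (y ^ n / (1 + y)) y := by
    intro y hy
    have hy' : 1 + y ≠ 0 := by linarith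
    have hsum : HasDerivAt (fun z : ℝ ↦ ∑ i ∈ range n, (-1) ^ i * z ^ (i + 1) / ((i : ℝ) + 1))
        (∑ i ∈ range n, (-y) ^ i) y := by
      refine HasDerivAt.fun_sum fun i _ ↦ ?_
      have h := ((hasDerivAt_pow (i + 1) y).const_mul ((-1 : ℝ) ^ i)).div_const ((i : ℝ) + 1)
      have hi : (i : ℝ) + 1 ≠ 0 := by positivity
      refine h.congr_deriv ?_
      rw [neg_pow y i]
      push_cast
      field_simp
    have hlog : HasDerivAt (fun z : ℝ ↦ Real.log (1 + z)) (1 / (1 + y)) y :=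
      ((hasDerivAt_id y).const_add 1).log hy'
    refine (hsum.sub hlog).congr_deriv ?_
    have hgeom := mul_neg_geom_sum (-y) n
    rw [hn.neg_pow, sub_neg_eq_add, sub_neg_eq_add] at hgeom
    field_simp
    linarith
  have hg0 : g 0 = 0 := by simp [hg]
  suffices 0 ≤ g z by simpa [hg] using this
  rcases le_total 0 z with h0 | h0
  · have hmono : MonotoneOn g (Set.Ici 0) := by
      refine monotoneOn_of_hasDerivWithinAt_nonneg (convex_Ici 0)
        (f' := fun y ↦ y ^ n / (1 + y))
        (fun y hy ↦ (hder y (by linarith [Set.mem_Ici.1 hy])).continuousAt.continuousWithinAt)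
        (fun y hy ↦ ?_) (fun y hy ↦ ?_) <;>
      · rw [interior_Ici, Set.mem_Ioi] at hy
        first
        | exact (hder y (by linarith)).hasDerivWithinAt
        | positivity
    exact hg0 ▸ hmono (Set.mem_Ici.2 le_rfl) h0 h0
  · have hanti : AntitoneOn g (Set.Ioc (-1) 0) := by
      refine antitoneOn_of_hasDerivWithinAt_nonpos (convex_Ioc (-1) 0)
        (f' := fun y ↦ y ^ n / (1 + y))
        (fun y hy ↦ (hder y hy.1).continuousAt.continuousWithinAt)
        (fun y hy ↦ ?_) (fun y hy ↦ ?_) <;>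
      rw [interior_Ioc, Set.mem_Ioo] at hy
      · exact (hder y hy.1).hasDerivWithinAt
      · exact div_nonpos_of_nonpos_of_nonneg (hn.pow_nonpos hy.2.le) (by linarith)
    exact hg0 ▸ hanti ⟨hz, h0⟩ ⟨by norm_num, le_rfl⟩ h0

/-- The polynomial with coefficients `l` (constant term first), evaluated at `y`. -/
def hornerEval : List ℝ → ℝ → ℝ
  | [], _ => 0
  | a :: l, y => a + y * hornerEval l y

/-- The sum of `a i * y ^ i / (k + i + 1)` over the entries `a i` of `l`. -/
noncomputable def hornerPrim : ℕ → List ℝ → ℝ → ℝ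
  | _, [], _ => 0
  | k, a :: l, y => a / (k + 1) + y * hornerPrim (k + 1) l y

lemma hasDerivAt_pow_mul_hornerPrim (l : List ℝ) (k : ℕ) (y : ℝ) :
    HasDerivAt (fun y ↦ y ^ (k + 1) * hornerPrim k l y) (y ^ k * hornerEval l y) y := by
  induction l generalizing k with
  | nil => simpa [hornerPrim, hornerEval] using hasDerivAt_const y (0 : ℝ)
  | cons a l ih =>
    have h := ((hasDerivAt_pow (k + 1) y).mul_const (a / ((k : ℝ) + 1))).add (ih (k + 1))
    have hk : (k : ℝ) + 1 ≠ 0 := by positivity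
    refine (h.congr_deriv ?_).congr_of_eventuallyEq (.of_forall fun z ↦ ?_)
    · simp only [hornerEval, Nat.add_sub_cancel]
      push_cast
      field_simp
      ring
    · simp only [hornerPrim, Pi.add_apply]
      ring

lemma hasDerivAt_mul_hornerPrim (l : List ℝ) (y : ℝ) :
    HasDerivAt (fun y ↦ y * hornerPrim 0 l y) (hornerEval l y) y := by
  simpa using hasDerivAt_pow_mul_hornerPrim l 0 y

lemma continuous_hornerEval (l : List ℝ) : Continuous (hornerEval l) := by
  induction l with
  | nil => exact continuous_const
  | cons a l ih => exact continuous_const.add (continuous_id.mul ih)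

/-- Coefficients of a polynomial in `u - 13 / 4` bounding `log (u - 1) / u` from above. -/
noncomputable def logDivCoeffs : List ℝ :=
  [810930217/3250000000, 5701628047/95062500000, -135814652423/2780578125000,
    5863995615421/243995730468750, -49464473692526/4757916744140625,
    2374789852930936/556676259064453125, -333706248116541088/195393366931623046875,
    36063135017789451392/53342389172333091796875, -1663720223648420250112/6241059533162971740234375,
    691071455473416161036288/6571835688420609242466796875,
    -3554821557552570244145152/85433863949467920152068359375,
    1818787919333448728681480192/109953382902965213235711978515625,
    -255213332591608683113599860736/38593637398940789845734904458984375,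
    4003107787956843724019198328832/1505151858558690803983661273900390625,
    -189526902557567568351795139837952/176102767451366824066088369046345703125,
    27081332707244543270196217502498816/61812071375429755247197017535267341796875]

/-- Coefficients of the polynomial part, in `t - 17 / 4`, of the upper bound for the integrand. -/
noncomputable def integrandCoeffs : List ℝ :=
  [72429968421910803313958691337177611902994243141532972619/13767234079072990941421153905582271582031250000000000000,
    -861274522512004312509571349352169283960057106010435423/688361703953649547071057695279113579101562500000000000,
    3383776886673966405821909480012935448124178222277497/11472695065894159117850961587985226318359375000000000,
    -119735169818597264805342274132575752274872413172447/1720904259884123867677644238197783947753906250000000,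
    108238029835585823348629823770807498790012928523/6618862538015861029529400916145322875976562500000,
    -68496973826247794048683733318890577355059681/17704776336256418391745311092569793701171875000,
    194781107516002702242503022811777288843288511/215113032485515483459705529774722993469238281250,
    -4658839105635767689288640180128934372293574/21511303248551548345970552977472299346923828125,
    71717219907952686778950014725639719039544/1434086883236769889731370198498153289794921875,
    -10653530490091673844932048845283520287776/860452129942061933838822119098891973876953125,
    36181692359249843798686635319519607936/13237725076031722059058801832290645751953125,
    -94839902429984581592395181397506380288/126199645724835750296360577467837489501953125,
    10840622966626968360506223638180452352/75719787434901450177816346480702493701171875,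
    -801438289437488009547449986206785536/15143957486980290035563269296140498740234375,
    298603065649072605695722280615936/48076055514223142970042124749652376953125,
    -423145823550695988596815898476544/86536899925601657346075824549374278515625]

lemma log_nine_div_four_le : Real.log (9 / 4) ≤ 810930217 / 10 ^ 9 := by
  have h : Real.log (9 / 4) = 2 * Real.log 3 - 2 * Real.log 2 := by
    rw [show (9 / 4 : ℝ) = 3 ^ 2 / 2 ^ 2 by norm_num, Real.log_div (by norm_num) (by norm_num),
      Real.log_pow, Real.log_pow]
    norm_num
  have h2 := Real.log_two_gt_d9
  have h3 := Real.log_three_lt_d9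
  norm_num at h2 h3
  linarith

lemma log_div_le_hornerEval {u : ℝ} (hu : 1 < u) :
    Real.log (u - 1) / u ≤ hornerEval logDivCoeffs (u - 13 / 4) := by
  obtain ⟨y, rfl⟩ : ∃ y, u = y + 13 / 4 := ⟨u - 13 / 4, by ring⟩
  rw [div_le_iff₀ (by linarith), add_sub_cancel_right,
    show y + 13 / 4 - 1 = 9 / 4 * (1 + 4 / 9 * y) by ring,
    Real.log_mul (by norm_num) (by linarith)]
  have h := log_one_add_le_sum_of_odd (n := 15) (by decide) (z := 4 / 9 * y) (by linarith)
  have hy : 0 ≤ 27081332707244543270196217502498816/61812071375429755247197017535267341796875 * y ^ 16 := by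
    positivity
  refine (add_le_add log_nine_div_four_le h).trans ?_
  refine (le_add_of_nonneg_right hy).trans (le_of_eq ?_)
  simp only [Finset.sum_range_succ, Finset.sum_range_zero, logDivCoeffs, hornerEval]
  push_cast
  ring

lemma integral_log_div_le {t : ℝ} (ht : 3 ≤ t) :
    ∫ u in (2:ℝ)..(t - 1), Real.log (u - 1) / u ≤
      (t - 17 / 4) * hornerPrim 0 logDivCoeffs (t - 17 / 4) +
        147060924543957441890296349108109124805518567/708910284190528776979053154708474089600000000 := by
  have hpoly : ∫ u in (2:ℝ)..(t - 1), hornerEval logDivCoeffs (u - 13 / 4) =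
      (t - 17 / 4) * hornerPrim 0 logDivCoeffs (t - 17 / 4) -
        (-5 / 4) * hornerPrim 0 logDivCoeffs (-5 / 4) := by
    rw [intervalIntegral.integral_comp_sub_right (hornerEval logDivCoeffs),
      intervalIntegral.integral_eq_sub_of_hasDerivAt
        (fun y _ ↦ hasDerivAt_mul_hornerPrim logDivCoeffs y)
        ((continuous_hornerEval _).intervalIntegrable _ _),
      show t - 1 - 13 / 4 = t - 17 / 4 by ring, show (2 : ℝ) - 13 / 4 = -5 / 4 by norm_num]
  have hconst : -((-5 / 4) * hornerPrim 0 logDivCoeffs (-5 / 4)) =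
      147060924543957441890296349108109124805518567/708910284190528776979053154708474089600000000 := by
    simp only [logDivCoeffs, hornerPrim]
    norm_num
  rw [← hconst, ← sub_eq_add_neg, ← hpoly]
  refine intervalIntegral.integral_mono_on (by linarith) (ContinuousOn.intervalIntegrable ?_)
    (((continuous_hornerEval _).comp (continuous_sub_right _)).intervalIntegrable _ _)
    fun u hu ↦ log_div_le_hornerEval (by linarith [hu.1])
  rw [Set.uIcc_of_le (by linarith)]
  exact ((continuous_sub_right _).continuousOn.log fun u hu ↦ by linarith [hu.1]).div
    continuousOn_id fun u hu ↦ by linarith [hu.1]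

lemma mul_hornerPrim_eq {t : ℝ} (h0 : t ≠ 0) (h1 : 6.6 - t ≠ 0) :
    (1 / t) * (1 / (6.6 - t) - 1 / 5.6) *
      ((t - 17 / 4) * hornerPrim 0 logDivCoeffs (t - 17 / 4) +
        147060924543957441890296349108109124805518567/708910284190528776979053154708474089600000000) =
      hornerEval integrandCoeffs (t - 17 / 4) +
        -480695287579888161488549044670053846774826359/21322692141668248370073083168965822226250000 * (1 / t) +
        1941118299794456290741049034271567383672589596694067/14897365459447901498754790008437203645706176757812500 *
          (1 / (6.6 - t)) := by
  obtain ⟨y, rfl⟩ : ∃ y, t = y + 17 / 4 := ⟨t - 17 / 4, by ring⟩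
  rw [show (1 / (y + 17 / 4)) * (1 / (6.6 - (y + 17 / 4)) - 1 / 5.6) =
    5 / 28 * (y + 13 / 4) * ((1 / (y + 17 / 4)) * (1 / (6.6 - (y + 17 / 4)))) by
      have hd : 1 / (6.6 - (y + 17 / 4)) * (6.6 - (y + 17 / 4)) = 1 := one_div_mul_cancel h1
      linear_combination (5 / 28 * (1 / (y + 17 / 4))) * hd]
  rw [add_sub_cancel_right]
  have key : 5 / 28 * (y + 13 / 4) * (y * hornerPrim 0 logDivCoeffs y +
        147060924543957441890296349108109124805518567/708910284190528776979053154708474089600000000) =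
      hornerEval integrandCoeffs y * ((y + 17 / 4) * (6.6 - (y + 17 / 4))) +
        -480695287579888161488549044670053846774826359/21322692141668248370073083168965822226250000 *
          (6.6 - (y + 17 / 4)) +
        1941118299794456290741049034271567383672589596694067/14897365459447901498754790008437203645706176757812500 *
          (y + 17 / 4) := by
    simp only [logDivCoeffs, integrandCoeffs, hornerPrim, hornerEval]
    push_cast
    ring
  generalize y * hornerPrim 0 logDivCoeffs y = P at *
  generalize hornerEval integrandCoeffs y = S at *
  generalize y + 17 / 4 = t at *
  calc _ = (5 / 28 * (y + 13 / 4) * (P +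
        147060924543957441890296349108109124805518567/708910284190528776979053154708474089600000000)) *
        (1 / t * (1 / (6.6 - t))) := by ring
    _ = _ := by
      rw [key]
      field_simp

lemma log_twentyEight_div_fifteen_gt : 0.624154308 < Real.log (28 / 15) := by
  have h : Real.log (28 / 15) = Real.log (28 / 27) + (2 * Real.log 3 - Real.log 5) := by
    rw [show (28 / 15 : ℝ) = 28 / 27 * (3 ^ 2 / 5) by norm_num,
      Real.log_mul (by norm_num) (by norm_num), Real.log_div (x := 3 ^ 2) (by norm_num)
        (by norm_num), Real.log_pow]
    norm_num
  have h27 := Real.sum_range_sub_log_div_le (x := 1 / 55) (by norm_num [abs_of_pos]) 3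
  rw [show ((1 : ℝ) + 1 / 55) / (1 - 1 / 55) = 28 / 27 by norm_num, abs_of_pos
    (by norm_num : (0 : ℝ) < 1 / 55)] at h27
  have h27 := (abs_le.1 h27).1
  have h3 := Real.log_three_gt_d9
  have h5 := Real.log_five_lt_d9
  norm_num [Finset.sum_range_succ] at h27 h3 h5 ⊢
  linarith

lemma log_eighteen_div_five_lt : Real.log (18 / 5) < 1.280933847 := by
  have h : Real.log (18 / 5) = Real.log 2 + 2 * Real.log 3 - Real.log 5 := by
    rw [show (18 / 5 : ℝ) = 2 * 3 ^ 2 / 5 by norm_num, Real.log_div (by norm_num) (by norm_num),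
      Real.log_mul (by norm_num) (by norm_num), Real.log_pow]
    norm_num
  have h2 := Real.log_two_lt_d9
  have h3 := Real.log_three_lt_d9
  have h5 := Real.log_five_gt_d9
  norm_num at h2 h3 h5 ⊢
  linarith

theorem stmt11 :
    (∫ t in (3:ℝ)..(5.6:ℝ), (1 / t) * (1 / (6.6 - t) - 1 / 5.6) *
        ∫ u in (2:ℝ)..(t - 1), Real.log (u - 1) / u)
      < 0.05558 := by
  set bound : ℝ → ℝ := fun t ↦ hornerEval integrandCoeffs (t - 17 / 4) +
        -480695287579888161488549044670053846774826359/21322692141668248370073083168965822226250000 * (1 / t) +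
        1941118299794456290741049034271567383672589596694067/14897365459447901498754790008437203645706176757812500 *
          (1 / (6.6 - t)) with hbound
  have hne : ∀ t ∈ Set.Icc (3 : ℝ) 5.6, t ≠ 0 ∧ 6.6 - t ≠ 0 := fun t ht ↦
    ⟨by linarith [ht.1], by norm_num at ht ⊢; linarith [ht.2]⟩
  have hcont : ContinuousOn bound (Set.uIcc 3 5.6) := by
    rw [Set.uIcc_of_le (by norm_num)]
    refine (((continuous_hornerEval _).comp (continuous_sub_right _)).continuousOn.add
      (continuousOn_const.mul (continuousOn_const.div continuousOn_id fun t ht ↦ (hne t ht).1))).add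
      (continuousOn_const.mul (continuousOn_const.div
        (continuousOn_const.sub continuousOn_id) fun t ht ↦ (hne t ht).2))
  have hint : IntervalIntegrable bound MeasureTheory.volume 3 5.6 := hcont.intervalIntegrable
  have hval : ∫ t in (3:ℝ)..5.6, bound t < 0.05558 := by
    have hder : ∀ t ∈ Set.uIcc (3 : ℝ) 5.6, HasDerivAt
        (fun t ↦ (t - 17 / 4) * hornerPrim 0 integrandCoeffs (t - 17 / 4) +
        -480695287579888161488549044670053846774826359/21322692141668248370073083168965822226250000 * Real.log t -
        1941118299794456290741049034271567383672589596694067/14897365459447901498754790008437203645706176757812500 *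
          Real.log (6.6 - t)) (bound t) t := by
      intro t ht
      rw [Set.uIcc_of_le (by norm_num)] at ht
      obtain ⟨h0, h1⟩ := hne t ht
      refine ((((hasDerivAt_mul_hornerPrim integrandCoeffs _).comp_sub_const t (17 / 4)).add
        ((Real.hasDerivAt_log h0).const_mul _)).sub
        ((((hasDerivAt_id t).const_sub 6.6).log h1).const_mul _)).congr_deriv ?_
      simp only [hbound, id]
      ring
    rw [intervalIntegral.integral_eq_sub_of_hasDerivAt hder hint]
    have hA := log_twentyEight_div_fifteen_gt
    have hB := log_eighteen_div_five_lt
    rw [show (28 / 15 : ℝ) = 5.6 / 3 by norm_num, Real.log_div (by norm_num) (by norm_num)] at hA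
    rw [show (18 / 5 : ℝ) = 6.6 - 3 by norm_num] at hB
    rw [show (6.6 - 5.6 : ℝ) = 1 by norm_num, Real.log_one]
    generalize Real.log 5.6 = x at *
    generalize Real.log 3 = y at *
    generalize Real.log (6.6 - 3) = z at *
    simp only [integrandCoeffs, hornerPrim]
    norm_num at hA hB ⊢
    linarith
  refine lt_of_le_of_lt ?_ hval
  refine intervalIntegral.integral_mono_on (by norm_num) (ContinuousOn.intervalIntegrable ?_) hint
    fun t ht ↦ ?_
  · rw [Set.uIcc_of_le (by norm_num)]
    have hinner : ContinuousOn (fun s : ℝ ↦ ∫ u in (2:ℝ)..s, Real.log (u - 1) / u)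
        (Set.uIcc 2 5) := by
      refine intervalIntegral.continuousOn_primitive_interval
        (ContinuousOn.integrableOn_compact isCompact_uIcc ?_)
      rw [Set.uIcc_of_le (by norm_num)]
      exact ((continuous_sub_right _).continuousOn.log fun u hu ↦ by linarith [hu.1]).div
        continuousOn_id fun u hu ↦ by linarith [hu.1]
    refine ContinuousOn.mul ((continuousOn_const.div continuousOn_id fun t ht ↦ ?_).mul
      ((continuousOn_const.div (continuousOn_const.sub continuousOn_id) fun t ht ↦ ?_).sub
        continuousOn_const)) (hinner.comp (continuous_sub_right _).continuousOn fun t ht ↦ ?_)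
    · exact (hne t ht).1
    · exact (hne t ht).2
    · rw [Set.uIcc_of_le (by norm_num)]
      norm_num at ht ⊢
      constructor <;> linarith [ht.1, ht.2]
  · have h1 : 1 ≤ 6.6 - t := by have := ht.2; norm_num at this ⊢; linarith
    have h3 : 3 ≤ t := ht.1
    refine (mul_le_mul_of_nonneg_left (integral_log_div_le h3) ?_).trans_eq
      (mul_hornerPrim_eq (by linarith) (by linarith))
    refine mul_nonneg (by positivity) (sub_nonneg.2 ?_)
    refine one_div_le_one_div_of_le (by linarith) ?_
    norm_num
    linarith
end

section
/- The lower linear sieve function f₃ satisfies f₃(6.6) > 0 and 2e^γ / f₃(6.6) < 3.5623, and also f₃(7) > 0 and 2e^γ / f₃(7) < 3.5622. -/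
theorem nonneg_of_mul_deriv_nonneg {f f' : ℝ → ℝ} {S : Set ℝ} [hS : S.OrdConnected]
    (h0 : (0 : ℝ) ∈ S) (hf : ∀ x ∈ S, HasDerivAt f (f' x) x) (hf' : ∀ x ∈ S, 0 ≤ x * f' x)
    (hf0 : f 0 = 0) {x : ℝ} (hx : x ∈ S) : 0 ≤ f x := by
  rcases lt_trichotomy x 0 with h | rfl | h
  · have hsub : Set.Icc x 0 ⊆ S := hS.out hx h0
    obtain ⟨ξ, hξ, he⟩ := exists_hasDerivAt_eq_slope f f' h
      (fun z hz => (hf z (hsub hz)).continuousAt.continuousWithinAt)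
      (fun z hz => hf z (hsub (Set.Ioo_subset_Icc_self hz)))
    have h1 := hf' ξ (hsub (Set.Ioo_subset_Icc_self hξ))
    have h2 : f' ξ ≤ 0 := nonpos_of_mul_nonneg_right h1 hξ.2
    rw [he, hf0, zero_sub, zero_sub, neg_div_neg_eq] at h2
    by_contra! h3
    exact absurd (div_pos_of_neg_of_neg h3 h) (not_lt.2 h2)
  · exact hf0.ge
  · have hsub : Set.Icc 0 x ⊆ S := hS.out h0 hx
    obtain ⟨ξ, hξ, he⟩ := exists_hasDerivAt_eq_slope f f' h
      (fun z hz => (hf z (hsub hz)).continuousAt.continuousWithinAt)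
      (fun z hz => hf z (hsub (Set.Ioo_subset_Icc_self hz)))
    have h1 := hf' ξ (hsub (Set.Ioo_subset_Icc_self hξ))
    have h2 : 0 ≤ f' ξ := nonneg_of_mul_nonneg_right h1 hξ.1
    rw [he, hf0, sub_zero, sub_zero] at h2
    by_contra! h3
    exact absurd (div_neg_of_neg_of_pos h3 h) (not_lt.2 h2)

theorem log_one_add_ge {y : ℝ} (hy : -(1 / 2) ≤ y) :
    y - y ^ 2 / 2 + y ^ 3 / 3 - y ^ 4 / 4 + y ^ 5 / 5 - y ^ 6 / 3 ≤ Real.log (1 + y) := by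
  have key := nonneg_of_mul_deriv_nonneg (S := Set.Ici (-(1 / 2) : ℝ))
    (f := fun y => Real.log (1 + y)
      - (y - y ^ 2 / 2 + y ^ 3 / 3 - y ^ 4 / 4 + y ^ 5 / 5 - y ^ 6 / 3))
    (f' := fun y => 1 / (1 + y) - (1 - y + y ^ 2 - y ^ 3 + y ^ 4 - 2 * y ^ 5))
    (by norm_num) ?_ ?_ (by simp) hy
  · linarith
  · intro x hx
    have hx' : (1 : ℝ) + x ≠ 0 := by have : -(1 / 2) ≤ x := hx; linarith
    have h1 := ((hasDerivAt_id x).const_add 1).log hx'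
    have h2 := (((((hasDerivAt_id x).sub ((hasDerivAt_pow 2 x).div_const 2)).add
      ((hasDerivAt_pow 3 x).div_const 3)).sub ((hasDerivAt_pow 4 x).div_const 4)).add
      ((hasDerivAt_pow 5 x).div_const 5)).sub ((hasDerivAt_pow 6 x).div_const 3)
    exact (h1.sub h2).congr_deriv (by simp only [id]; push_cast; ring)
  · intro x hx
    have hx' : 0 < 1 + x := by have : -(1 / 2) ≤ x := hx; linarith
    have : x * (1 / (1 + x) - (1 - x + x ^ 2 - x ^ 3 + x ^ 4 - 2 * x ^ 5))
        = x ^ 6 * (1 + 2 * x) / (1 + x) := by field_simp; ring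
    rw [this]
    have : 0 ≤ 1 + 2 * x := by have : -(1 / 2) ≤ x := hx; linarith
    positivity

theorem log_one_add_le {y : ℝ} (hy : -1 < y) :
    Real.log (1 + y) ≤ y - y ^ 2 / 2 + y ^ 3 / 3 := by
  have key := nonneg_of_mul_deriv_nonneg (S := Set.Ioi (-1 : ℝ))
    (f := fun y => y - y ^ 2 / 2 + y ^ 3 / 3 - Real.log (1 + y))
    (f' := fun y => 1 - y + y ^ 2 - 1 / (1 + y))
    (by norm_num) ?_ ?_ (by simp) hy
  · linarith
  · intro x hx
    have hx' : (1 : ℝ) + x ≠ 0 := by have : -1 < x := hx; linarith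
    have h1 := ((hasDerivAt_id x).const_add 1).log hx'
    have h2 := ((hasDerivAt_id x).sub ((hasDerivAt_pow 2 x).div_const 2)).add
      ((hasDerivAt_pow 3 x).div_const 3)
    exact (h2.sub h1).congr_deriv (by simp only [id]; push_cast; ring)
  · intro x hx
    have hx' : 0 < 1 + x := by have : -1 < x := hx; linarith
    have : x * (1 - x + x ^ 2 - 1 / (1 + x)) = x ^ 4 / (1 + x) := by field_simp; ring
    rw [this]
    positivity

theorem le_log_of_sum {q x r : ℝ} (n : ℕ) (h₀ : 0 ≤ x) (h₁ : x < 1) (hq : q = (1 + x) / (1 - x))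
    (hr : r ≤ 2 * ∑ i ∈ Finset.range n, x ^ (2 * i + 1) / (2 * i + 1)) : r ≤ Real.log q := by
  have := Real.sum_range_le_log_div h₀ h₁ n
  rw [hq]
  linarith

/-- Coefficients of a polynomial lower bound for `log (c - 1 + v)`. -/
noncomputable def logCoeff (c k : ℝ) (i : ℕ) : ℝ :=
  if i = 0 then k else if i = 6 then -(1 / 3) / (c - 1) ^ 6 else (-1) ^ (i + 1) / (i * (c - 1) ^ i)

/-- Coefficients of a polynomial lower bound for `1 / (c + v)`. -/
noncomputable def invCoeff (c : ℝ) (j : ℕ) : ℝ := (-1) ^ j / c ^ (j + 1)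

/-- Coefficients of a polynomial lower bound for `log (S / (c + 1 + v))`. -/
noncomputable def logDivCoeff (c k : ℝ) (i : ℕ) : ℝ :=
  if i = 0 then k else (-1) ^ i / (i * (c + 1) ^ i)

theorem integral_mul_polynomials (a b e : ℕ → ℝ) (n m l : ℕ) (x y : ℝ) :
    ∫ v in x..y, (∑ i ∈ Finset.range n, a i * v ^ i) * (∑ j ∈ Finset.range m, b j * v ^ j) *
        (∑ k ∈ Finset.range l, e k * v ^ k)
      = ∑ i ∈ Finset.range n, ∑ j ∈ Finset.range m, ∑ k ∈ Finset.range l,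
          a i * b j * e k * ((y ^ (i + j + k + 1) - x ^ (i + j + k + 1)) / (i + j + k + 1)) := by
  have : ∀ v : ℝ, (∑ i ∈ Finset.range n, a i * v ^ i) * (∑ j ∈ Finset.range m, b j * v ^ j) *
        (∑ k ∈ Finset.range l, e k * v ^ k) = ∑ i ∈ Finset.range n, ∑ j ∈ Finset.range m,
          ∑ k ∈ Finset.range l, a i * b j * e k * v ^ (i + j + k) := by
    intro v
    rw [Finset.sum_mul_sum, Finset.sum_mul]
    refine Finset.sum_congr rfl fun i _ => ?_
    rw [Finset.sum_mul]
    refine Finset.sum_congr rfl fun j _ => ?_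
    rw [Finset.mul_sum]
    refine Finset.sum_congr rfl fun k _ => ?_
    ring
  simp_rw [this]
  rw [intervalIntegral.integral_finsetSum
    fun i _ => (by fun_prop : Continuous _).intervalIntegrable _ _]
  refine Finset.sum_congr rfl fun i _ => ?_
  rw [intervalIntegral.integral_finsetSum
    fun i _ => (by fun_prop : Continuous _).intervalIntegrable _ _]
  refine Finset.sum_congr rfl fun j _ => ?_
  rw [intervalIntegral.integral_finsetSum
    fun i _ => (by fun_prop : Continuous _).intervalIntegrable _ _]
  refine Finset.sum_congr rfl fun k _ => ?_
  rw [intervalIntegral.integral_const_mul, integral_pow]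
  push_cast
  ring

theorem mul_le_mul_of_nonneg_or {p q l r : ℝ} (hl : 0 ≤ l) (hr : 0 ≤ r) (hp : p ≤ l) (hq : q ≤ r)
    (h : 0 ≤ p ∨ 0 ≤ q) : p * q ≤ l * r := by
  rcases h with h | h
  · exact (mul_le_mul_of_nonneg_left hq h).trans (mul_le_mul_of_nonneg_right hp hr)
  · exact (mul_le_mul_of_nonneg_right hp h).trans (mul_le_mul_of_nonneg_left hq hl)

theorem neg_abs_le_log_taylor {y : ℝ} (hy : |y| ≤ 1 / 4) :
    -(5 / 4 * |y|) ≤ y - y ^ 2 / 2 + y ^ 3 / 3 - y ^ 4 / 4 + y ^ 5 / 5 - y ^ 6 / 3 := by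
  have step : ∀ n : ℕ, |y| ^ (n + 1) ≤ |y| * (1 / 4) ^ n := fun n => by
    rw [pow_succ']
    gcongr
  have h1 := neg_abs_le y
  have h2 := (le_abs_self (y ^ 2)).trans_eq (abs_pow y 2) |>.trans (step 1)
  have h3 := (neg_le_abs (y ^ 3)).trans_eq (abs_pow y 3) |>.trans (step 2)
  have h4 := (le_abs_self (y ^ 4)).trans_eq (abs_pow y 4) |>.trans (step 3)
  have h5 := (neg_le_abs (y ^ 5)).trans_eq (abs_pow y 5) |>.trans (step 4)
  have h6 := (le_abs_self (y ^ 6)).trans_eq (abs_pow y 6) |>.trans (step 5)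
  have := abs_nonneg y
  norm_num at h2 h3 h4 h5 h6
  linarith

theorem integrand_ge {c d S k₁ k₃ v : ℝ} (hc : 1 < c) (hd : 4 * d ≤ c - 1) (hcd : 2 ≤ c - d)
    (hS : c + d + 1 ≤ S) (hk₁ : k₁ ≤ Real.log (c - 1)) (hk₃ : k₃ ≤ Real.log (S / (c + 1)))
    (h : 5 * d ≤ 4 * (k₁ * (c - 1)) ∨ d ≤ k₃ * (c + 1)) (hv₁ : -d ≤ v) (hv₂ : v ≤ d) :
    (∑ i ∈ Finset.range 7, logCoeff c k₁ i * v ^ i) *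
        (∑ j ∈ Finset.range 6, invCoeff c j * v ^ j) *
        (∑ k ∈ Finset.range 4, logDivCoeff c k₃ k * v ^ k)
      ≤ Real.log (c + v - 1) / (c + v) * Real.log (S / (c + v + 1)) := by
  have hc1 : 0 < c - 1 := by linarith
  have hc0 : 0 < c := by linarith
  have hc2 : 0 < c + 1 := by linarith
  have hcv : 0 < c + v := by linarith
  set P₁ := ∑ i ∈ Finset.range 7, logCoeff c k₁ i * v ^ i with hP₁
  set P₂ := ∑ j ∈ Finset.range 6, invCoeff c j * v ^ j with hP₂
  set P₃ := ∑ k ∈ Finset.range 4, logDivCoeff c k₃ k * v ^ k with hP₃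
  obtain ⟨y, hy⟩ : ∃ y, y = v / (c - 1) := ⟨_, rfl⟩
  obtain ⟨z, hz⟩ : ∃ z, z = v / c := ⟨_, rfl⟩
  obtain ⟨w, hw⟩ : ∃ w, w = v / (c + 1) := ⟨_, rfl⟩
  have e₁ : P₁ = k₁ + (y - y ^ 2 / 2 + y ^ 3 / 3 - y ^ 4 / 4 + y ^ 5 / 5 - y ^ 6 / 3) := by
    rw [hP₁, hy]
    simp [Finset.sum_range_succ, logCoeff, div_pow]
    generalize c - 1 = x
    ring
  have e₂ : P₂ = 1 / c * ((1 - z) * (1 + z ^ 2 + z ^ 4)) := by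
    rw [hP₂, hz]
    simp only [Finset.sum_range_succ, Finset.sum_range_zero, invCoeff]
    field_simp
    ring
  have e₃ : P₃ = k₃ - (w - w ^ 2 / 2 + w ^ 3 / 3) := by
    rw [hP₃, hw]
    simp [Finset.sum_range_succ, logDivCoeff, div_pow]
    generalize c + 1 = x
    ring
  have hy1 : -(1 / 4) ≤ y := by rw [hy, le_div_iff₀ hc1]; linarith
  have hy2 : y ≤ 1 / 4 := by rw [hy, div_le_iff₀ hc1]; linarith
  have hz1 : -1 < z := by rw [hz, lt_div_iff₀ hc0]; linarith
  have hz2 : z ≤ 1 := by rw [hz, div_le_iff₀ hc0]; linarith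
  have hw1 : -1 < w := by rw [hw, lt_div_iff₀ hc2]; linarith
  have hw2 : w ≤ 1 := by rw [hw, div_le_iff₀ hc2]; linarith
  have l₁ : P₁ ≤ Real.log (c + v - 1) := by
    have : c + v - 1 = (c - 1) * (1 + y) := by rw [hy]; field_simp; ring
    rw [this, Real.log_mul hc1.ne' (by linarith), e₁]
    exact add_le_add hk₁ (log_one_add_ge (by linarith))
  have l₂ : P₂ ≤ 1 / (c + v) := by
    have : c + v = c * (1 + z) := by rw [hz]; field_simp
    have hz0 : 0 < 1 + z := by linarith
    rw [this, e₂, one_div_mul_eq_div, div_le_div_iff₀ hc0 (by positivity)]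
    have : 0 ≤ c * z ^ 6 := by positivity
    linarith
  have l₃ : P₃ ≤ Real.log (S / (c + v + 1)) := by
    have : S / (c + v + 1) = S / (c + 1) / (1 + w) := by
      rw [hw, div_div]; congr 1; field_simp; ring
    have hS0 : 0 < S := by linarith
    rw [this, Real.log_div (by positivity) (by linarith), e₃]
    exact sub_le_sub hk₃ (log_one_add_le hw1)
  have n₁ : 0 ≤ Real.log (c + v - 1) := Real.log_nonneg (by linarith)
  have n₂ : 0 ≤ P₂ := by
    rw [e₂]
    have : 0 ≤ 1 - z := by linarith
    positivity
  have n₃ : 0 ≤ Real.log (S / (c + v + 1)) :=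
    Real.log_nonneg (by rw [le_div_iff₀ (by linarith)]; linarith)
  have hor : 0 ≤ P₁ ∨ 0 ≤ P₃ := by
    rcases h with h | h
    · left
      have hk : 5 / 4 * (d / (c - 1)) ≤ k₁ := by
        rw [← mul_div_assoc, div_le_iff₀ hc1]; linarith
      have hyd : -(d / (c - 1)) ≤ y := by rw [hy, ← neg_div]; gcongr
      have hyd' : y ≤ d / (c - 1) := by rw [hy]; gcongr
      rw [e₁]
      have := neg_abs_le_log_taylor (abs_le.2 ⟨hy1, hy2⟩)
      have : |y| ≤ d / (c - 1) := abs_le.2 ⟨hyd, hyd'⟩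
      linarith
    · right
      have hk : w ≤ k₃ := by rw [hw, div_le_iff₀ hc2]; linarith
      rw [e₃]
      nlinarith [sq_nonneg w]
  calc P₁ * P₂ * P₃ = P₁ * P₃ * P₂ := by ring
    _ ≤ Real.log (c + v - 1) * Real.log (S / (c + v + 1)) * P₂ :=
        mul_le_mul_of_nonneg_right (mul_le_mul_of_nonneg_or n₁ n₃ l₁ l₃ hor) n₂
    _ ≤ Real.log (c + v - 1) * Real.log (S / (c + v + 1)) * (1 / (c + v)) :=
        mul_le_mul_of_nonneg_left l₂ (mul_nonneg n₁ n₃)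
    _ = _ := by ring

theorem integral_piece_ge {a b S : ℝ} (c d k₁ k₃ : ℝ) (ha : a = c - d) (hb : b = c + d)
    (hc : 1 < c) (hd₀ : 0 ≤ d)
    (hd : 4 * d ≤ c - 1) (hcd : 2 ≤ c - d)
    (hS : c + d + 1 ≤ S) (hk₁ : k₁ ≤ Real.log (c - 1)) (hk₃ : k₃ ≤ Real.log (S / (c + 1)))
    (h : 5 * d ≤ 4 * (k₁ * (c - 1)) ∨ d ≤ k₃ * (c + 1)) :
    ∑ i ∈ Finset.range 7, ∑ j ∈ Finset.range 6, ∑ k ∈ Finset.range 4,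
        logCoeff c k₁ i * invCoeff c j * logDivCoeff c k₃ k *
          ((d ^ (i + j + k + 1) - (-d) ^ (i + j + k + 1)) / (i + j + k + 1))
      ≤ ∫ u in a..b, Real.log (u - 1) / u * Real.log (S / (u + 1)) := by
  have e : ∫ u in a..b, Real.log (u - 1) / u * Real.log (S / (u + 1))
      = ∫ v in (-d)..d, Real.log (c + v - 1) / (c + v) * Real.log (S / (c + v + 1)) := by
    rw [intervalIntegral.integral_comp_add_left
      (fun u => Real.log (u - 1) / u * Real.log (S / (u + 1))) c, ha, hb, sub_eq_add_neg]
  rw [e, ← integral_mul_polynomials]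
  refine intervalIntegral.integral_mono_on (by linarith)
    ((by fun_prop : Continuous _).intervalIntegrable _ _) ?_
    fun v hv => integrand_ge hc hd hcd hS hk₁ hk₃ h hv.1 hv.2
  refine ContinuousOn.intervalIntegrable fun v hv => ContinuousAt.continuousWithinAt ?_
  rw [Set.uIcc_of_le (by linarith)] at hv
  have h1 : c + v - 1 ≠ 0 := by linarith [hv.1]
  have h2 : c + v ≠ 0 := by linarith [hv.1]
  have h3 : c + v + 1 ≠ 0 := by linarith [hv.1]
  have h4 : S / (c + v + 1) ≠ 0 := div_ne_zero (by linarith) h3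
  fun_prop (disch := assumption)

theorem continuousAt_log_sub_one_div {u : ℝ} (hu : 1 < u) :
    ContinuousAt (fun u : ℝ => Real.log (u - 1) / u) u := by
  have h1 : u - 1 ≠ 0 := by linarith
  have h2 : u ≠ 0 := by linarith
  fun_prop (disch := assumption)

theorem intervalIntegrable_log_sub_one_div {a b : ℝ} (ha : 1 < a) (hb : 1 < b) :
    IntervalIntegrable (fun u : ℝ => Real.log (u - 1) / u) MeasureTheory.volume a b :=
  ContinuousOn.intervalIntegrable fun _ hv =>
    (continuousAt_log_sub_one_div ((lt_min ha hb).trans_le hv.1)).continuousWithinAt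

/-- Integration by parts turns the iterated integral into a single one. -/
theorem integral_inv_mul_integral_eq {s : ℝ} (hs : 4 ≤ s) :
    ∫ t in (3 : ℝ)..(s - 1), (1 / t) * ∫ u in (2 : ℝ)..(t - 1), Real.log (u - 1) / u
      = ∫ u in (2 : ℝ)..(s - 2), Real.log (u - 1) / u * Real.log ((s - 1) / (u + 1)) := by
  have hle : (3 : ℝ) ≤ s - 1 := by linarith
  have hcont : ContinuousOn (fun t : ℝ => Real.log (t - 1 - 1) / (t - 1)) (Set.uIcc 3 (s - 1)) := by
    rw [Set.uIcc_of_le hle]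
    intro t ht
    exact (ContinuousAt.comp (f := fun t : ℝ => t - 1)
      (continuousAt_log_sub_one_div (by linarith [ht.1])) (by fun_prop)).continuousWithinAt
  have hlog : ContinuousOn Real.log (Set.uIcc 3 (s - 1)) := by
    rw [Set.uIcc_of_le hle]
    exact fun t ht => (Real.continuousAt_log (by linarith [ht.1])).continuousWithinAt
  have parts := intervalIntegral.integral_mul_deriv_eq_deriv_mul (a := 3) (b := s - 1)
    (u := fun t => ∫ u in (2 : ℝ)..(t - 1), Real.log (u - 1) / u)
    (u' := fun t => Real.log (t - 1 - 1) / (t - 1)) (v := Real.log) (v' := fun t => 1 / t)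
    (fun t ht => by
      rw [Set.uIcc_of_le hle] at ht
      have hm : Measurable fun u : ℝ => Real.log (u - 1) / u := by fun_prop
      have := intervalIntegral.integral_hasDerivAt_right
        (intervalIntegrable_log_sub_one_div (a := 2) (b := t - 1) (by norm_num)
          (by linarith [ht.1]))
        hm.stronglyMeasurable.stronglyMeasurableAtFilter
        (continuousAt_log_sub_one_div (by linarith [ht.1]))
      exact (this.comp t ((hasDerivAt_id t).sub_const 1)).congr_deriv (mul_one _))
    (fun t ht => by
      rw [Set.uIcc_of_le hle] at ht
      simpa using Real.hasDerivAt_log (by linarith [ht.1] : t ≠ 0))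
    hcont.intervalIntegrable
    (ContinuousOn.intervalIntegrable fun t ht => by
      rw [Set.uIcc_of_le hle] at ht
      have : t ≠ 0 := by linarith [ht.1]
      exact ContinuousAt.continuousWithinAt (by fun_prop (disch := assumption)))
  have shift : ∀ g : ℝ → ℝ,
      ∫ u in (2 : ℝ)..(s - 2), g u = ∫ t in (3 : ℝ)..(s - 1), g (t - 1) := fun g => by
    rw [intervalIntegral.integral_comp_sub_right]
    congr 1 <;> ring
  have hzero : ∫ u in (2 : ℝ)..(3 - 1), Real.log (u - 1) / u = 0 := by norm_num
  calc ∫ t in (3 : ℝ)..(s - 1), (1 / t) * ∫ u in (2 : ℝ)..(t - 1), Real.log (u - 1) / u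
      = ∫ t in (3 : ℝ)..(s - 1), (∫ u in (2 : ℝ)..(t - 1), Real.log (u - 1) / u) * (1 / t) := by
        simp_rw [mul_comm]
    _ = (∫ u in (2 : ℝ)..(s - 2), Real.log (u - 1) / u) * Real.log (s - 1)
          - ∫ t in (3 : ℝ)..(s - 1), Real.log (t - 1 - 1) / (t - 1) * Real.log t := by
        rw [parts, hzero]
        ring_nf
    _ = ∫ t in (3 : ℝ)..(s - 1), (Real.log (t - 1 - 1) / (t - 1) * Real.log (s - 1)
          - Real.log (t - 1 - 1) / (t - 1) * Real.log t) := by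
        rw [shift, ← intervalIntegral.integral_mul_const, intervalIntegral.integral_sub]
        · exact (hcont.mul continuousOn_const).intervalIntegrable
        · exact (hcont.mul hlog).intervalIntegrable
    _ = _ := by
        rw [shift]
        refine intervalIntegral.integral_congr fun t ht => ?_
        rw [Set.uIcc_of_le hle] at ht
        rw [sub_add_cancel, Real.log_div (by linarith) (by linarith [ht.1])]
        ring

theorem intervalIntegrable_log_mul_log {a b S : ℝ} (ha : 1 < a) (hb : 1 < b) (hS : 0 < S) :
    IntervalIntegrable (fun u : ℝ => Real.log (u - 1) / u * Real.log (S / (u + 1)))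
      MeasureTheory.volume a b := by
  refine ContinuousOn.intervalIntegrable fun u hu => ContinuousAt.continuousWithinAt ?_
  have hu' : 1 < u := (lt_min ha hb).trans_le hu.1
  have h1 := continuousAt_log_sub_one_div hu'
  have h3 : u + 1 ≠ 0 := by linarith
  have h4 : S / (u + 1) ≠ 0 := div_ne_zero hS.ne' h3
  exact h1.mul (by fun_prop (disch := assumption))

theorem triple_integrand_nonneg {s t u : ℝ} (ht : 2 ≤ t) (hu : t + 2 ≤ u) (hus : u ≤ s - 2) :
    0 ≤ (1 / u) * Real.log ((u - 1) / (t + 1)) * Real.log (s / (u + 2)) := by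
  have h1 : 0 ≤ Real.log ((u - 1) / (t + 1)) :=
    Real.log_nonneg (by rw [le_div_iff₀ (by linarith)]; linarith)
  have h2 : 0 ≤ Real.log (s / (u + 2)) :=
    Real.log_nonneg (by rw [le_div_iff₀ (by linarith)]; linarith)
  have h3 : 0 < u := by linarith
  positivity

theorem triple_integral_nonneg {s : ℝ} (hs : 6 ≤ s) :
    0 ≤ ∫ t in (2:ℝ)..(s - 4), (Real.log (t - 1) / t) *
          ∫ u in (t + 2)..(s - 2),
            (1 / u) * Real.log ((u - 1) / (t + 1)) * Real.log (s / (u + 2)) := by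
  refine intervalIntegral.integral_nonneg (by linarith) fun t ht => ?_
  refine mul_nonneg (div_nonneg (Real.log_nonneg (by linarith [ht.1])) (by linarith [ht.1])) ?_
  exact intervalIntegral.integral_nonneg (by linarith [ht.2]) fun u hu =>
    triple_integrand_nonneg ht.1 hu.1 hu.2

theorem sub_div_le_log_div {x y : ℝ} (hx : 0 < x) (hy : 0 < y) :
    (x - y) / x ≤ Real.log (x / y) := by
  have := Real.one_sub_inv_le_log_of_pos (div_pos hx hy)
  rwa [inv_div, one_sub_div hx.ne'] at this

theorem inner_integrand_ge {t u : ℝ} (ht : 2 ≤ t) (hu : t + 2 ≤ u) (hu5 : u ≤ 5) :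
    1 / 140 * ((u - (t + 2)) * (5 - u)) ≤
      (1 / u) * Real.log ((u - 1) / (t + 1)) * Real.log (7 / (u + 2)) := by
  have h1 : (u - (t + 2)) / 4 ≤ Real.log ((u - 1) / (t + 1)) := by
    refine le_trans ?_ (sub_div_le_log_div (by linarith) (by linarith))
    rw [show u - 1 - (t + 1) = u - (t + 2) by ring]
    exact div_le_div_of_nonneg_left (by linarith) (by linarith) (by linarith)
  have h2 : (5 - u) / 7 ≤ Real.log (7 / (u + 2)) := by
    refine le_trans (le_of_eq ?_) (sub_div_le_log_div (by norm_num) (by linarith))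
    ring
  have h3 : (1 / 5 : ℝ) ≤ 1 / u := one_div_le_one_div_of_le (by linarith) hu5
  have n1 : 0 ≤ (u - (t + 2)) / 4 := by linarith
  have n2 : 0 ≤ (5 - u) / 7 := by linarith
  have n3 : (0 : ℝ) ≤ 1 / u := le_trans (by norm_num) h3
  calc 1 / 140 * ((u - (t + 2)) * (5 - u)) = 1 / 5 * ((u - (t + 2)) / 4) * ((5 - u) / 7) := by ring
    _ ≤ _ := mul_le_mul (mul_le_mul h3 h1 n1 n3) h2 n2 (mul_nonneg n3 (n1.trans h1))

theorem inner_integral_ge {t : ℝ} (ht : 2 ≤ t) (ht3 : t ≤ 3) :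
    (3 - t) ^ 3 / 840 ≤ ∫ u in (t + 2)..5,
      (1 / u) * Real.log ((u - 1) / (t + 1)) * Real.log (7 / (u + 2)) := by
  have e : (3 - t) ^ 3 / 840 = ∫ u in (t + 2)..5, 1 / 140 * ((u - (t + 2)) * (5 - u)) := by
    have : ∀ u : ℝ, 1 / 140 * ((u - (t + 2)) * (5 - u))
        = (t + 7) / 140 * u - 1 / 140 * u ^ 2 - (t + 2) / 28 := fun u => by ring
    simp_rw [this]
    rw [intervalIntegral.integral_sub ((by fun_prop : Continuous _).intervalIntegrable _ _)
      ((by fun_prop : Continuous _).intervalIntegrable _ _),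
      intervalIntegral.integral_sub ((by fun_prop : Continuous _).intervalIntegrable _ _)
      ((by fun_prop : Continuous _).intervalIntegrable _ _),
      intervalIntegral.integral_const_mul, intervalIntegral.integral_const_mul,
      integral_id, integral_pow, intervalIntegral.integral_const, smul_eq_mul]
    push_cast
    ring
  rw [e]
  refine intervalIntegral.integral_mono_on (by linarith)
    ((by fun_prop : Continuous _).intervalIntegrable _ _) ?_
    fun u hu => inner_integrand_ge ht hu.1 hu.2
  refine ContinuousOn.intervalIntegrable fun u hu => ContinuousAt.continuousWithinAt ?_
  rw [Set.uIcc_of_le (by linarith)] at hu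
  have h1 : u ≠ 0 := by linarith [hu.1]
  have h2 : t + 1 ≠ 0 := by linarith
  have h3 : (u - 1) / (t + 1) ≠ 0 := div_ne_zero (by linarith [hu.1]) h2
  have h4 : u + 2 ≠ 0 := by linarith [hu.1]
  have h5 : 7 / (u + 2) ≠ 0 := div_ne_zero (by norm_num) h4
  fun_prop (disch := assumption)

theorem continuousOn_inner_integral :
    ContinuousOn (fun t : ℝ => ∫ u in (t + 2)..5,
      (1 / u) * Real.log ((u - 1) / (t + 1)) * Real.log (7 / (u + 2))) (Set.Icc 2 3) := by
  let g : ℝ → ℝ := fun u => 1 / u * Real.log (7 / (u + 2))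
  let h : ℝ → ℝ := fun u => 1 / u * Real.log (u - 1) * Real.log (7 / (u + 2))
  have hg : ContinuousOn g (Set.Icc 4 5) := fun u hu => ContinuousAt.continuousWithinAt <| by
    have h1 : u ≠ 0 := by linarith [hu.1]
    have h4 : u + 2 ≠ 0 := by linarith [hu.1]
    have h5 : 7 / (u + 2) ≠ 0 := div_ne_zero (by norm_num) h4
    fun_prop (disch := assumption)
  have hh : ContinuousOn h (Set.Icc 4 5) := fun u hu => ContinuousAt.continuousWithinAt <| by
    have h1 : u ≠ 0 := by linarith [hu.1]
    have h2 : u - 1 ≠ 0 := by linarith [hu.1]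
    have h4 : u + 2 ≠ 0 := by linarith [hu.1]
    have h5 : 7 / (u + 2) ≠ 0 := div_ne_zero (by norm_num) h4
    fun_prop (disch := assumption)
  have prim : ∀ f : ℝ → ℝ, ContinuousOn f (Set.Icc 4 5) →
      ContinuousOn (fun t : ℝ => ∫ u in (t + 2)..5, f u) (Set.Icc 2 3) := fun f hf => by
    rw [← Set.uIcc_of_le (by norm_num : (4 : ℝ) ≤ 5)] at hf
    have := intervalIntegral.continuousOn_primitive_interval' (a := 5)
      (μ := MeasureTheory.volume) hf.intervalIntegrable Set.right_mem_uIcc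
    rw [Set.uIcc_of_le (by norm_num : (4 : ℝ) ≤ 5)] at this
    have := (this.comp (f := fun t : ℝ => t + 2) (s := Set.Icc 2 3) (by fun_prop)
      fun t ht => ⟨by linarith [ht.1], by linarith [ht.2]⟩).neg
    refine this.congr fun t _ => ?_
    exact intervalIntegral.integral_symm _ _
  have hl : ContinuousOn (fun t : ℝ => Real.log (t + 1)) (Set.Icc 2 3) := fun t ht =>
    ContinuousAt.continuousWithinAt <| by
      have h1 : t + 1 ≠ 0 := by linarith [ht.1]
      fun_prop (disch := assumption)
  refine ((prim h hh).sub (hl.mul (prim g hg))).congr fun t ht => ?_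
  have hsub : Set.uIcc (t + 2) 5 ⊆ Set.Icc 4 5 := by
    rw [Set.uIcc_of_le (by linarith [ht.2])]
    exact Set.Icc_subset_Icc_left (by linarith [ht.1])
  simp only [Pi.sub_apply, Pi.mul_apply]
  rw [← intervalIntegral.integral_const_mul, ← intervalIntegral.integral_sub
    (hh.mono hsub).intervalIntegrable ((hg.mono hsub).intervalIntegrable.const_mul _)]
  refine intervalIntegral.integral_congr fun u hu => ?_
  have hu4 := (hsub hu).1
  simp only [g, h]
  rw [Real.log_div (by linarith) (by linarith [ht.1])]
  ring

theorem triple_integral_seven_ge :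
    2 / 100000 ≤ ∫ t in (2:ℝ)..3, (Real.log (t - 1) / t) *
          ∫ u in (t + 2)..5,
            (1 / u) * Real.log ((u - 1) / (t + 1)) * Real.log (7 / (u + 2)) := by
  have e : ∫ t in (2:ℝ)..3,
      ((t - 2) / 2 - (t - 2) ^ 2 / 2 + (t - 2) ^ 3 / 8) * ((3 - t) ^ 3 / 840) = 59 / 2822400 := by
    rw [intervalIntegral.integral_eq_sub_of_hasDerivAt (f := fun t => (1 / 840) *
      ((t - 2) ^ 2 / 4 - 2 / 3 * (t - 2) ^ 3 + 25 / 32 * (t - 2) ^ 4 - 19 / 40 * (t - 2) ^ 5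
        + 7 / 48 * (t - 2) ^ 6 - (t - 2) ^ 7 / 56))]
    · norm_num
    · intro t _
      have p : ∀ n : ℕ, HasDerivAt (fun t : ℝ => (t - 2) ^ n) (n * (t - 2) ^ (n - 1)) t :=
        fun n => (((hasDerivAt_id t).sub_const 2).pow n).congr_deriv (mul_one _)
      exact ((((((((p 2).div_const 4).sub ((p 3).const_mul (2 / 3))).add
        ((p 4).const_mul (25 / 32))).sub ((p 5).const_mul (19 / 40))).add
        ((p 6).const_mul (7 / 48))).sub ((p 7).div_const 56)).const_mul (1 / 840)).congr_deriv
        (by push_cast; ring)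
    · exact (by fun_prop : Continuous _).intervalIntegrable _ _
  calc (2 / 100000 : ℝ) ≤ 59 / 2822400 := by norm_num
    _ = _ := e.symm
    _ ≤ _ := by
      refine intervalIntegral.integral_mono_on (by norm_num)
        ((by fun_prop : Continuous _).intervalIntegrable _ _) ?_ fun t ht => ?_
      · have h1 : ContinuousOn (fun t : ℝ => Real.log (t - 1) / t) (Set.Icc 2 3) := fun t ht =>
          (continuousAt_log_sub_one_div (by linarith [ht.1])).continuousWithinAt
        have h2 := h1.mul continuousOn_inner_integral
        rw [← Set.uIcc_of_le (by norm_num)] at h2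
        exact h2.intervalIntegrable
      · obtain ⟨ht2, ht3⟩ := ht
        refine mul_le_mul ?_ (inner_integral_ge ht2 ht3)
          (div_nonneg (pow_nonneg (by linarith) 3) (by norm_num))
          (div_nonneg (Real.log_nonneg (by linarith)) (by linarith))
        obtain ⟨y, rfl⟩ : ∃ y, t = 2 + y := ⟨t - 2, by ring⟩
        have hy : 0 ≤ y := by linarith
        have hy1 : 0 ≤ 1 - y := by linarith
        rw [le_div_iff₀ (by linarith), show 2 + y - 1 = 1 + y by ring,
          show 2 + y - 2 = y by ring]
        refine le_trans ?_ (Real.le_log_one_add_of_nonneg hy)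
        rw [le_div_iff₀ (by linarith)]
        have h3 : 0 ≤ y ^ 3 * (7 + (1 - y) * (1 + y)) := by positivity
        linarith

theorem integral_six_ge_of_two :
    0.0275960 ≤ ∫ u in (2 : ℝ)..2.5, Real.log (u - 1) / u * Real.log (6 / (u + 1)) := by
  refine le_trans ?_ (integral_piece_ge 2.25 0.25 0.2231435 0.6131044
    (by norm_num) (by norm_num) (by norm_num) (by norm_num) (by norm_num) (by norm_num)
    (by norm_num)
    (le_log_of_sum (x := 1 / 9) 5 (by norm_num) (by norm_num) (by norm_num)
      (by norm_num [Finset.sum_range_succ]))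
    (le_log_of_sum (x := 11 / 37) 9 (by norm_num) (by norm_num) (by norm_num)
      (by norm_num [Finset.sum_range_succ]))
    (by norm_num))
  simp only [Finset.sum_range_succ, Finset.sum_range_zero, logCoeff, invCoeff, logDivCoeff]
  norm_num

theorem integral_six_ge_of_five_halves :
    0.0695333 ≤ ∫ u in (2.5 : ℝ)..3.25, Real.log (u - 1) / u * Real.log (6 / (u + 1)) := by
  refine le_trans ?_ (integral_piece_ge 2.875 0.375 0.6286086 0.4372138
    (by norm_num) (by norm_num) (by norm_num) (by norm_num) (by norm_num) (by norm_num)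
    (by norm_num)
    (le_log_of_sum (x := 7 / 23) 9 (by norm_num) (by norm_num) (by norm_num)
      (by norm_num [Finset.sum_range_succ]))
    (le_log_of_sum (x := 17 / 79) 7 (by norm_num) (by norm_num) (by norm_num)
      (by norm_num [Finset.sum_range_succ]))
    (by norm_num))
  simp only [Finset.sum_range_succ, Finset.sum_range_zero, logCoeff, invCoeff, logDivCoeff]
  norm_num

theorem integral_six_ge_of_thirteen_quarters :
    0.0625564 ≤ ∫ u in (3.25 : ℝ)..4.25, Real.log (u - 1) / u * Real.log (6 / (u + 1)) := by
  refine le_trans ?_ (integral_piece_ge 3.75 0.5 1.0116009 0.2336148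
    (by norm_num) (by norm_num) (by norm_num) (by norm_num) (by norm_num) (by norm_num)
    (by norm_num)
    (le_log_of_sum (x := 7 / 15) 14 (by norm_num) (by norm_num) (by norm_num)
      (by norm_num [Finset.sum_range_succ]))
    (le_log_of_sum (x := 5 / 43) 5 (by norm_num) (by norm_num) (by norm_num)
      (by norm_num [Finset.sum_range_succ]))
    (by norm_num))
  simp only [Finset.sum_range_succ, Finset.sum_range_zero, logCoeff, invCoeff, logDivCoeff]
  norm_num

theorem integral_six_ge_of_seventeen_quarters :
    0.0136155 ≤ ∫ u in (4.25 : ℝ)..5, Real.log (u - 1) / u * Real.log (6 / (u + 1)) := by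
  refine le_trans ?_ (integral_piece_ge 4.625 0.375 1.2878542 0.0645385
    (by norm_num) (by norm_num) (by norm_num) (by norm_num) (by norm_num) (by norm_num)
    (by norm_num)
    (le_log_of_sum (x := 21 / 37) 18 (by norm_num) (by norm_num) (by norm_num)
      (by norm_num [Finset.sum_range_succ]))
    (le_log_of_sum (x := 1 / 31) 5 (by norm_num) (by norm_num) (by norm_num)
      (by norm_num [Finset.sum_range_succ]))
    (by norm_num))
  simp only [Finset.sum_range_succ, Finset.sum_range_zero, logCoeff, invCoeff, logDivCoeff]
  norm_num

theorem integral_six_ge :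
    0.1733012 ≤ ∫ u in (2 : ℝ)..5, Real.log (u - 1) / u * Real.log (6 / (u + 1)) := by
  have hi : ∀ a b : ℝ, 1 < a → 1 < b → IntervalIntegrable
      (fun u : ℝ => Real.log (u - 1) / u * Real.log (6 / (u + 1))) MeasureTheory.volume a b :=
    fun a b ha hb => intervalIntegrable_log_mul_log ha hb (by norm_num)
  have h1 := intervalIntegral.integral_add_adjacent_intervals
    (hi 2 2.5 (by norm_num) (by norm_num)) (hi 2.5 3.25 (by norm_num) (by norm_num))
  have h2 := intervalIntegral.integral_add_adjacent_intervals
    (hi 2 3.25 (by norm_num) (by norm_num)) (hi 3.25 4.25 (by norm_num) (by norm_num))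
  have h3 := intervalIntegral.integral_add_adjacent_intervals
    (hi 2 4.25 (by norm_num) (by norm_num)) (hi 4.25 5 (by norm_num) (by norm_num))
  linarith [integral_six_ge_of_two,
    integral_six_ge_of_five_halves,
    integral_six_ge_of_thirteen_quarters,
    integral_six_ge_of_seventeen_quarters]

theorem integral_twenty_eight_fifths_ge_of_two :
    0.0243802 ≤ ∫ u in (2 : ℝ)..2.5, Real.log (u - 1) / u * Real.log (5.6 / (u + 1)) := by
  refine le_trans ?_ (integral_piece_ge 2.25 0.25 0.2231435 0.5441116
    (by norm_num) (by norm_num) (by norm_num) (by norm_num) (by norm_num) (by norm_num)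
    (by norm_num)
    (le_log_of_sum (x := 1 / 9) 5 (by norm_num) (by norm_num) (by norm_num)
      (by norm_num [Finset.sum_range_succ]))
    (le_log_of_sum (x := 47 / 177) 8 (by norm_num) (by norm_num) (by norm_num)
      (by norm_num [Finset.sum_range_succ]))
    (by norm_num))
  simp only [Finset.sum_range_succ, Finset.sum_range_zero, logCoeff, invCoeff, logDivCoeff]
  norm_num

theorem integral_twenty_eight_fifths_ge_of_five_halves :
    0.0584369 ≤ ∫ u in (2.5 : ℝ)..3.25, Real.log (u - 1) / u * Real.log (5.6 / (u + 1)) := by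
  refine le_trans ?_ (integral_piece_ge 2.875 0.375 0.6286086 0.3682209
    (by norm_num) (by norm_num) (by norm_num) (by norm_num) (by norm_num) (by norm_num)
    (by norm_num)
    (le_log_of_sum (x := 7 / 23) 9 (by norm_num) (by norm_num) (by norm_num)
      (by norm_num [Finset.sum_range_succ]))
    (le_log_of_sum (x := 69 / 379) 6 (by norm_num) (by norm_num) (by norm_num)
      (by norm_num [Finset.sum_range_succ]))
    (by norm_num))
  simp only [Finset.sum_range_succ, Finset.sum_range_zero, logCoeff, invCoeff, logDivCoeff]
  norm_num

theorem integral_twenty_eight_fifths_ge_of_thirteen_quarters :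
    0.0471884 ≤ ∫ u in (3.25 : ℝ)..4.6, Real.log (u - 1) / u * Real.log (5.6 / (u + 1)) := by
  refine le_trans ?_ (integral_piece_ge 3.925 0.675 1.0732944 0.1284423
    (by norm_num) (by norm_num) (by norm_num) (by norm_num) (by norm_num) (by norm_num)
    (by norm_num)
    (le_log_of_sum (x := 77 / 157) 15 (by norm_num) (by norm_num) (by norm_num)
      (by norm_num [Finset.sum_range_succ]))
    (le_log_of_sum (x := 27 / 421) 5 (by norm_num) (by norm_num) (by norm_num)
      (by norm_num [Finset.sum_range_succ]))
    (by norm_num))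
  simp only [Finset.sum_range_succ, Finset.sum_range_zero, logCoeff, invCoeff, logDivCoeff]
  norm_num

theorem integral_twenty_eight_fifths_ge :
    0.1300055 ≤ ∫ u in (2 : ℝ)..4.6, Real.log (u - 1) / u * Real.log (5.6 / (u + 1)) := by
  have hi : ∀ a b : ℝ, 1 < a → 1 < b → IntervalIntegrable
      (fun u : ℝ => Real.log (u - 1) / u * Real.log (5.6 / (u + 1))) MeasureTheory.volume a b :=
    fun a b ha hb => intervalIntegrable_log_mul_log ha hb (by norm_num)
  have h1 := intervalIntegral.integral_add_adjacent_intervals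
    (hi 2 2.5 (by norm_num) (by norm_num)) (hi 2.5 3.25 (by norm_num) (by norm_num))
  have h2 := intervalIntegral.integral_add_adjacent_intervals
    (hi 2 3.25 (by norm_num) (by norm_num)) (hi 3.25 4.6 (by norm_num) (by norm_num))
  linarith [integral_twenty_eight_fifths_ge_of_two,
    integral_twenty_eight_fifths_ge_of_five_halves,
    integral_twenty_eight_fifths_ge_of_thirteen_quarters]

theorem two_mul_exp_div_f₃_lt {s c : ℝ} (hs : 0 < s) (hc : 0 < c)
    (h : s / c < Real.log (s - 1)
      + (∫ t in (3:ℝ)..(s - 1), (1 / t) * ∫ u in (2:ℝ)..(t - 1), Real.log (u - 1) / u)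
      + ∫ t in (2:ℝ)..(s - 4), (Real.log (t - 1) / t) *
          ∫ u in (t + 2)..(s - 2),
            (1 / u) * Real.log ((u - 1) / (t + 1)) * Real.log (s / (u + 2))) :
    0 < f₃ s ∧ 2 * Real.exp Real.eulerMascheroniConstant / f₃ s < c := by
  rw [f₃]
  set G := Real.log (s - 1)
      + (∫ t in (3:ℝ)..(s - 1), (1 / t) * ∫ u in (2:ℝ)..(t - 1), Real.log (u - 1) / u)
      + ∫ t in (2:ℝ)..(s - 4), (Real.log (t - 1) / t) *
          ∫ u in (t + 2)..(s - 2),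
            (1 / u) * Real.log ((u - 1) / (t + 1)) * Real.log (s / (u + 2))
  have hG : 0 < G := (div_pos hs hc).trans h
  have hE := Real.exp_pos Real.eulerMascheroniConstant
  refine ⟨by positivity, ?_⟩
  rw [div_lt_iff₀ hc] at h
  have e : c * (2 * Real.exp Real.eulerMascheroniConstant / s * G)
      = 2 * Real.exp Real.eulerMascheroniConstant * (G * c / s) := by ring
  rw [div_lt_iff₀ (by positivity), e]
  refine lt_mul_of_one_lt_right (by positivity) ?_
  rwa [lt_div_iff₀ hs, one_mul]

theorem stmt13 :
    0 < f₃ 6.6 ∧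
    2 * Real.exp Real.eulerMascheroniConstant / f₃ 6.6 < 3.5623 ∧
    0 < f₃ 7 ∧
    2 * Real.exp Real.eulerMascheroniConstant / f₃ 7 < 3.5622 := by
  have h6 := two_mul_exp_div_f₃_lt (s := 6.6) (c := 3.5623) (by norm_num) (by norm_num) <| by
    have hA : (1.7227665 : ℝ) ≤ Real.log (6.6 - 1) :=
      (le_log_of_sum (x := 23 / 33) 29 (by norm_num) (by norm_num) (by norm_num)
        (by norm_num [Finset.sum_range_succ]))
    have hB := integral_twenty_eight_fifths_ge
    have hC := triple_integral_nonneg (s := 6.6) (by norm_num)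
    rw [integral_inv_mul_integral_eq (by norm_num)]
    norm_num at hA hB hC ⊢
    linarith
  have h7 := two_mul_exp_div_f₃_lt (s := 7) (c := 3.5622) (by norm_num) (by norm_num) <| by
    have hA : (1.7917594 : ℝ) ≤ Real.log (7 - 1) :=
      (le_log_of_sum (x := 5 / 7) 31 (by norm_num) (by norm_num) (by norm_num)
        (by norm_num [Finset.sum_range_succ]))
    have hB := integral_six_ge
    have hC := triple_integral_seven_ge
    rw [integral_inv_mul_integral_eq (by norm_num)]
    norm_num at hA hB hC ⊢
    linarith
  exact ⟨h6.1, h6.2, h7.1, h7.2⟩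
end

section
/- With a = 1, b = 7 and τ = 1/4 (so that b/((b−a)τ) = 14/3), one has 14/3 − 1 + (2e^γ / f₃(7)) · (I₁(1, 7) + I₂(1, 7) + I₃(1, 7)) < 5. In particular r = 5 is an admissible value in the weighted linear sieve with level of distribution τ = 1/4. -/
/-- The quantity `I₁(a,b)`. -/
noncomputable def I₁ (a b : ℝ) : ℝ :=
  (1 / b) * Real.log ((b - 1) * (b - a) / a) - (1 / (b - a)) * Real.log ((b - 1) / a)

/-- The quantity `I₂(a,b)`. -/
noncomputable def I₂ (a b : ℝ) : ℝ :=
  ∫ t in (3:ℝ)..(b - 1), (1 / t) * (1 / (b - t) - 1 / (b - a)) *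
    ∫ u in (2:ℝ)..(t - 1), Real.log (u - 1) / u

/-- The quantity `I₃(a,b)`. -/
noncomputable def I₃ (a b : ℝ) : ℝ :=
  ∫ t in (5:ℝ)..(b - 1), (1 / t) * (1 / (b - t) - 1 / (b - a)) *
    ∫ u in (2:ℝ)..(t - 3), (Real.log (u - 1) / u) *
      ∫ v in (u + 2)..(t - 1), (1 / v) * Real.log ((v - 1) / (u + 1))

theorem integral_mem_Icc_of_mem_Icc {f g : ℝ → ℝ} {a b : ℝ} (hab : a ≤ b) (hg : Continuous g)
    (h : ∀ x ∈ Set.Icc a b, 0 ≤ f x ∧ f x ≤ g x) :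
    0 ≤ ∫ x in a..b, f x ∧ ∫ x in a..b, f x ≤ ∫ x in a..b, g x := by
  refine ⟨intervalIntegral.integral_nonneg hab fun x hx => (h x hx).1, ?_⟩
  refine (le_abs_self _).trans ?_
  rw [← Real.norm_eq_abs]
  refine intervalIntegral.norm_integral_le_of_norm_le hab ?_ (hg.intervalIntegrable a b)
  refine Filter.Eventually.of_forall fun x hx => ?_
  have hx' := h x (Set.Ioc_subset_Icc_self hx)
  rw [Real.norm_eq_abs, abs_of_nonneg hx'.1]
  exact hx'.2

theorem integral_mem_Icc_of_le_const {f : ℝ → ℝ} {a b c : ℝ} (hab : a ≤ b)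
    (h : ∀ x ∈ Set.Icc a b, 0 ≤ f x ∧ f x ≤ c) :
    0 ≤ ∫ x in a..b, f x ∧ ∫ x in a..b, f x ≤ (b - a) * c := by
  simpa using integral_mem_Icc_of_mem_Icc hab (continuous_const (y := c)) h

theorem log_sub_one_div_mem_Icc {u : ℝ} (hu : 2 ≤ u) :
    0 ≤ Real.log (u - 1) / u ∧ Real.log (u - 1) / u ≤ 2 / 7 := by
  refine ⟨div_nonneg (Real.log_nonneg (by linarith)) (by linarith), ?_⟩
  rw [div_le_iff₀ (by linarith)]
  have hsplit : Real.log (u - 1) =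
      Real.log (2 * (u - 1) / 7) + (2 * Real.log 2 + Real.log (7 / 8)) := by
    have h2 : 2 * Real.log 2 = Real.log 4 := by
      rw [show (4 : ℝ) = 2 ^ 2 by norm_num, Real.log_pow]
      norm_num
    rw [h2, ← Real.log_mul (by norm_num) (by norm_num),
      ← Real.log_mul (by linarith : 0 < 2 * (u - 1) / 7).ne' (by norm_num)]
    congr 1
    ring
  have h1 := Real.log_le_sub_one_of_pos (by linarith : 0 < 2 * (u - 1) / 7)
  have h2 := Real.log_le_sub_one_of_pos (by norm_num : (0 : ℝ) < 7 / 8)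
  linarith [Real.log_two_lt_d9]

theorem integral_log_sub_one_div_mem_Icc {t : ℝ} (ht : 3 ≤ t) :
    0 ≤ ∫ u in (2 : ℝ)..(t - 1), Real.log (u - 1) / u ∧
      ∫ u in (2 : ℝ)..(t - 1), Real.log (u - 1) / u ≤ (t - 3) * (2 / 7) := by
  have h := integral_mem_Icc_of_le_const (by linarith : (2 : ℝ) ≤ t - 1)
    (fun u hu => log_sub_one_div_mem_Icc hu.1)
  exact ⟨h.1, h.2.trans (by linarith)⟩

theorem weight_mem_Icc {t : ℝ} (h3 : 3 ≤ t) (h6 : t ≤ 6) :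
    0 ≤ 1 / t * (1 / (7 - t) - 1 / (7 - 1)) ∧
      1 / t * (1 / (7 - t) - 1 / (7 - 1)) ≤ 4 / 125 + 3 / 250 * (t - 3) ^ 2 := by
  have ht : 0 < t := by linarith
  have ht7 : 0 < 7 - t := by linarith
  have e : 1 / t * (1 / (7 - t) - 1 / (7 - 1)) = (t - 1) / (6 * t * (7 - t)) := by
    field_simp
    ring
  rw [e]
  refine ⟨div_nonneg (by linarith) (by positivity), ?_⟩
  rw [div_le_iff₀ (by positivity)]
  nlinarith [mul_nonneg (sub_nonneg.2 h3) (sub_nonneg.2 h6),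
    mul_nonneg (mul_nonneg (sub_nonneg.2 h3) (sub_nonneg.2 h6)) (sq_nonneg (t - 4)),
    mul_nonneg (mul_nonneg (sub_nonneg.2 h3) (sub_nonneg.2 h6)) (sq_nonneg (t - 5))]

theorem I₂_one_seven_le : I₂ 1 7 ≤ 1 / 9 := by
  have h := (integral_mem_Icc_of_mem_Icc
    (f := fun t => (1 / t) * (1 / (7 - t) - 1 / (7 - 1)) *
      ∫ u in (2:ℝ)..(t - 1), Real.log (u - 1) / u)
    (g := fun t => (4 / 125 + 3 / 250 * (t - 3) ^ 2) * ((t - 3) * (2 / 7)))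
    (by norm_num : (3 : ℝ) ≤ 7 - 1) (by fun_prop) (fun t ht => by
      have hk := weight_mem_Icc ht.1 (by linarith [ht.2])
      have hg := integral_log_sub_one_div_mem_Icc ht.1
      exact ⟨mul_nonneg hk.1 hg.1, mul_le_mul hk.2 hg.2 hg.1 (by positivity)⟩)).2
  refine h.trans ?_
  rw [intervalIntegral.integral_comp_sub_right
    (fun x : ℝ => (4 / 125 + 3 / 250 * x ^ 2) * (x * (2 / 7))) 3]
  have e : (fun x : ℝ => (4 / 125 + 3 / 250 * x ^ 2) * (x * (2 / 7))) =
      fun x => 8 / 875 * x ^ 1 + 3 / 875 * x ^ 3 := by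
    funext x
    ring
  rw [e, intervalIntegral.integral_add
    (Continuous.intervalIntegrable (by fun_prop) _ _)
    (Continuous.intervalIntegrable (by fun_prop) _ _),
    intervalIntegral.integral_const_mul, intervalIntegral.integral_const_mul,
    integral_pow, integral_pow]
  norm_num

theorem I₃_one_seven_le : I₃ 1 7 ≤ 1 / 200 := by
  have hv : ∀ u t : ℝ, 2 ≤ u → u + 2 ≤ t - 1 → t ≤ 6 →
      0 ≤ ∫ v in (u + 2)..(t - 1), (1 / v) * Real.log ((v - 1) / (u + 1)) ∧
        ∫ v in (u + 2)..(t - 1), (1 / v) * Real.log ((v - 1) / (u + 1)) ≤ 1 / 12 := by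
    intro u t hu hut ht
    have h := integral_mem_Icc_of_le_const (c := 1 / 4 * (1 / 3))
      (f := fun v => (1 / v) * Real.log ((v - 1) / (u + 1))) hut (fun v hv => by
        obtain ⟨hv1, hv2⟩ := hv
        have hr : 1 ≤ (v - 1) / (u + 1) := by
          rw [le_div_iff₀ (by linarith)]
          linarith
        have hr' : (v - 1) / (u + 1) ≤ 4 / 3 := by
          rw [div_le_iff₀ (by linarith)]
          linarith
        have hlog := Real.log_nonneg hr
        have hlog' := Real.log_le_sub_one_of_pos (by linarith : 0 < (v - 1) / (u + 1))
        have hv0 : 0 ≤ 1 / v := one_div_nonneg.2 (by linarith)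
        exact ⟨mul_nonneg hv0 hlog, mul_le_mul
          (one_div_le_one_div_of_le (by norm_num) (by linarith)) (by linarith) hlog
          (by norm_num)⟩)
    exact ⟨h.1, h.2.trans (by linarith)⟩
  have hu : ∀ t : ℝ, 5 ≤ t → t ≤ 6 →
      0 ≤ ∫ u in (2:ℝ)..(t - 3), (Real.log (u - 1) / u) *
        ∫ v in (u + 2)..(t - 1), (1 / v) * Real.log ((v - 1) / (u + 1)) ∧
      ∫ u in (2:ℝ)..(t - 3), (Real.log (u - 1) / u) *
        ∫ v in (u + 2)..(t - 1), (1 / v) * Real.log ((v - 1) / (u + 1)) ≤ 1 / 42 := by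
    intro t h5 h6
    have h := integral_mem_Icc_of_le_const (c := 2 / 7 * (1 / 12))
      (f := fun u => (Real.log (u - 1) / u) *
        ∫ v in (u + 2)..(t - 1), (1 / v) * Real.log ((v - 1) / (u + 1)))
      (by linarith : (2 : ℝ) ≤ t - 3) (fun u hu => by
        have h1 := log_sub_one_div_mem_Icc hu.1
        have h2 := hv u t hu.1 (by linarith [hu.2]) h6
        exact ⟨mul_nonneg h1.1 h2.1, mul_le_mul h1.2 h2.2 h2.1 (by norm_num)⟩)
    exact ⟨h.1, h.2.trans (by linarith)⟩
  have h := (integral_mem_Icc_of_le_const (c := 1 / 5 * (1 / 42))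
    (f := fun t => (1 / t) * (1 / (7 - t) - 1 / (7 - 1)) *
      ∫ u in (2:ℝ)..(t - 3), (Real.log (u - 1) / u) *
        ∫ v in (u + 2)..(t - 1), (1 / v) * Real.log ((v - 1) / (u + 1)))
    (by norm_num : (5 : ℝ) ≤ 7 - 1) (fun t ht => by
      have h6 : t ≤ 6 := by linarith [ht.2]
      have hk := weight_mem_Icc (by linarith [ht.1]) h6
      have hk' : (4 : ℝ) / 125 + 3 / 250 * (t - 3) ^ 2 ≤ 1 / 5 := by nlinarith [ht.1]
      have hi := hu t ht.1 h6
      exact ⟨mul_nonneg hk.1 hi.1, mul_le_mul (hk.2.trans hk') hi.2 hi.1 (by norm_num)⟩)).2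
  exact h.trans (by norm_num)

theorem I₁_one_seven : I₁ 1 7 = 5 / 42 * Real.log 6 := by
  have e : Real.log 36 = 2 * Real.log 6 := by
    rw [show (36 : ℝ) = 6 ^ 2 by norm_num, Real.log_pow]
    norm_num
  unfold I₁
  norm_num [e]
  ring

theorem exists_f₃_seven_eq : ∃ L : ℝ, Real.log 6 ≤ L ∧
    f₃ 7 = 2 * Real.exp Real.eulerMascheroniConstant / 7 * L := by
  refine ⟨_, ?_, rfl⟩
  have hJ : 0 ≤ ∫ t in (3:ℝ)..(7 - 1), (1 / t) * ∫ u in (2:ℝ)..(t - 1), Real.log (u - 1) / u :=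
    intervalIntegral.integral_nonneg (by norm_num) fun t ht =>
      mul_nonneg (one_div_nonneg.2 (by linarith [ht.1])) (integral_log_sub_one_div_mem_Icc ht.1).1
  have hK : 0 ≤ ∫ t in (2:ℝ)..(7 - 4), (Real.log (t - 1) / t) *
      ∫ u in (t + 2)..(7 - 2), (1 / u) * Real.log ((u - 1) / (t + 1)) * Real.log (7 / (u + 2)) := by
    refine intervalIntegral.integral_nonneg (by norm_num) fun t ht => ?_
    refine mul_nonneg (log_sub_one_div_mem_Icc ht.1).1 ?_
    refine intervalIntegral.integral_nonneg (by linarith [ht.2]) fun u hu => ?_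
    obtain ⟨ht1, ht2⟩ := ht
    obtain ⟨hu1, hu2⟩ := hu
    refine mul_nonneg (mul_nonneg (one_div_nonneg.2 (by linarith)) (Real.log_nonneg ?_))
      (Real.log_nonneg ?_)
    · rw [le_div_iff₀ (by linarith)]
      linarith
    · rw [le_div_iff₀ (by linarith)]
      linarith
  have e : Real.log (7 - 1) = Real.log 6 := by norm_num
  linarith

theorem log_six_gt : (1.69 : ℝ) < Real.log 6 := by
  have h3 : 1 < Real.log 3 := by
    rw [Real.lt_log_iff_exp_lt (by norm_num)]
    linarith [Real.exp_one_lt_d9]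
  rw [show (6 : ℝ) = 2 * 3 by norm_num, Real.log_mul (by norm_num) (by norm_num)]
  linarith [Real.log_two_gt_d9]

theorem stmt15 :
    (14 / 3 : ℝ) - 1
      + (2 * Real.exp Real.eulerMascheroniConstant / f₃ 7)
        * (I₁ 1 7 + I₂ 1 7 + I₃ 1 7) < 5 := by
  obtain ⟨L, hL, hf⟩ := exists_f₃_seven_eq
  have h6 := log_six_gt
  have hL0 : 0 < L := by linarith
  have hE := Real.exp_pos Real.eulerMascheroniConstant
  have e : 2 * Real.exp Real.eulerMascheroniConstant / f₃ 7 = 7 / L := by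
    rw [hf]
    field_simp
  have key : 7 / L * (I₁ 1 7 + I₂ 1 7 + I₃ 1 7) < 4 / 3 := by
    rw [div_mul_eq_mul_div, div_lt_iff₀ hL0]
    linarith [I₁_one_seven, I₂_one_seven_le, I₃_one_seven_le]
  rw [e]
  linarith
end
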